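/- Let n ≥ 2, α ∈ (0,1), and let f : S^n → (0,∞) be a positive α-Hölder continuous function, extended to ℝ^{n+1}\{0} as a function homogeneous of degree −1. Let u : ℝ^{n+1} → ℝ be continuous, homogeneous of degree 1, of class C² on ℝ^{n+1}\{0}, and satisfy Δu = f on ℝ^{n+1}\{0}. If the Hölder seminorm [f]_{C^α(S^n)} := sup_{x≠z ∈ S^n} |f(x) − f(z)| / dist_{S^n}(x,z)^α satisfies [f]_{C^α(S^n)} ≤ γ_{n,α} · min_{S^n} f, then u is convex on ℝ^{n+1}. -/

import Mathlib

open MeasureTheory Metric Set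
open scoped RealInnerProductSpace

/-- The Euclidean Laplacian of `u : ℝ^m → ℝ`, as the sum of second partial
derivatives along the standard coordinate directions. -/
noncomputable def laplacian {m : ℕ} (u : EuclideanSpace ℝ (Fin m) → ℝ)
    (x : EuclideanSpace ℝ (Fin m)) : ℝ :=
  ∑ i, fderiv ℝ (fun y => fderiv ℝ u y (EuclideanSpace.single i 1)) x (EuclideanSpace.single i 1)

/-- `ω_n`, the total surface measure of the unit sphere `Sⁿ ⊂ ℝ^{n+1}`. -/
noncomputable def omega_n (n : ℕ) : ℝ :=
  ((volume : Measure (EuclideanSpace ℝ (Fin (n + 1)))).toSphere Set.univ).toReal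

/-- The constant `γ_{n,α}` of the paper, computed with the fixed unit vector
`e = EuclideanSpace.single 0 1` (the value does not depend on this choice). -/
noncomputable def gammaConst (n : ℕ) (α : ℝ) : ℝ :=
  omega_n n / (n * (n + 1)) *
    (∫ y : EuclideanSpace ℝ (Fin (n + 1)),
      (‖y - EuclideanSpace.single (0 : Fin (n + 1)) (1 : ℝ)‖ ^ (n + 1))⁻¹ * ‖y‖⁻¹ *
        Real.arccos ⟪‖y‖⁻¹ • y, EuclideanSpace.single (0 : Fin (n + 1)) (1 : ℝ)⟫ ^ α)⁻¹

open Filter Topology Module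

section Cutoff

variable {E : Type*} [NormedAddCommGroup E]

/-- A smooth cutoff that vanishes to second order at the origin and at infinity, and tends to `1`
elsewhere as `δ → 0`. -/
noncomputable def cutoff (δ : ℝ) (y : E) : ℝ :=
  ‖y‖ ^ 2 / (δ + ‖y‖ ^ 2 + δ * (‖y‖ ^ 2) ^ 2)

/-- The derivative of `cutoff` with respect to `‖y‖ ^ 2`. -/
noncomputable def cutoffSlope (δ : ℝ) (y : E) : ℝ :=
  δ * (1 - (‖y‖ ^ 2) ^ 2) / (δ + ‖y‖ ^ 2 + δ * (‖y‖ ^ 2) ^ 2) ^ 2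

lemma continuous_cutoff {δ : ℝ} (hδ : 0 < δ) : Continuous (cutoff δ : E → ℝ) := by
  unfold cutoff
  exact Continuous.div (by fun_prop) (by fun_prop) fun y => by positivity

lemma cutoff_nonneg {δ : ℝ} (hδ : 0 < δ) (y : E) : 0 ≤ cutoff δ y := by
  unfold cutoff; positivity

lemma cutoff_le_one {δ : ℝ} (hδ : 0 < δ) (y : E) : cutoff δ y ≤ 1 := by
  unfold cutoff
  rw [div_le_one (by positivity)]
  have : 0 ≤ δ * (‖y‖ ^ 2) ^ 2 := by positivity
  linarith

lemma cutoff_le_norm_sq {δ : ℝ} (hδ : 0 < δ) (y : E) : cutoff δ y ≤ δ⁻¹ * ‖y‖ ^ 2 := by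
  unfold cutoff
  rw [div_le_iff₀ (by positivity)]
  have : δ⁻¹ * ‖y‖ ^ 2 * (δ + ‖y‖ ^ 2 + δ * (‖y‖ ^ 2) ^ 2) =
      ‖y‖ ^ 2 + δ⁻¹ * ‖y‖ ^ 2 * (‖y‖ ^ 2 + δ * (‖y‖ ^ 2) ^ 2) := by
    field_simp; ring
  rw [this]
  have : 0 ≤ δ⁻¹ * ‖y‖ ^ 2 * (‖y‖ ^ 2 + δ * (‖y‖ ^ 2) ^ 2) := by positivity
  linarith

lemma norm_mul_cutoff_le {δ : ℝ} (hδ : 0 < δ) (y : E) : ‖y‖ * cutoff δ y ≤ 1 + δ⁻¹ := by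
  unfold cutoff
  rw [mul_div_assoc', div_le_iff₀ (by positivity)]
  have h1 : (1 + δ⁻¹) * (δ + ‖y‖ ^ 2 + δ * (‖y‖ ^ 2) ^ 2) =
      1 + δ + (1 + δ⁻¹) * ‖y‖ ^ 2 + δ * (‖y‖ ^ 2) ^ 2 + ‖y‖ ^ 4 := by
    field_simp; ring
  have h2 : 0 ≤ δ⁻¹ * ‖y‖ ^ 2 := by positivity
  have h3 : 0 ≤ δ * (‖y‖ ^ 2) ^ 2 := by positivity
  rw [h1]
  nlinarith [sq_nonneg (‖y‖ ^ 2 - ‖y‖), sq_nonneg (‖y‖)]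

lemma abs_cutoffSlope_mul_le {δ : ℝ} (hδ : 0 < δ) (y : E) :
    |cutoffSlope δ y| * ‖y‖ ^ 2 ≤ 1 := by
  unfold cutoffSlope
  rw [abs_div, abs_of_nonneg (a := (δ + ‖y‖ ^ 2 + δ * (‖y‖ ^ 2) ^ 2) ^ 2) (by positivity),
    div_mul_eq_mul_div, div_le_one (by positivity), abs_mul, abs_of_pos hδ,
    sq (δ + ‖y‖ ^ 2 + δ * (‖y‖ ^ 2) ^ 2)]
  have h : |1 - (‖y‖ ^ 2) ^ 2| ≤ 1 + (‖y‖ ^ 2) ^ 2 := by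
    rw [abs_le]; constructor <;> nlinarith [sq_nonneg (‖y‖ ^ 2)]
  have h3 : 0 ≤ δ * (‖y‖ ^ 2) ^ 2 := by positivity
  have h4 : 0 ≤ ‖y‖ ^ 2 := by positivity
  refine mul_le_mul ?_ ?_ h4 (by positivity)
  · nlinarith
  · linarith

lemma tendsto_cutoff {y : E} (hy : y ≠ 0) :
    Tendsto (fun δ : ℝ => cutoff δ y) (𝓝[>] 0) (𝓝 1) := by
  have hy' : ‖y‖ ^ 2 ≠ 0 := by positivity
  have h : ContinuousAt (fun δ : ℝ => cutoff δ y) 0 := by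
    unfold cutoff
    exact ContinuousAt.div (by fun_prop) (by fun_prop) (by simpa using hy)
  have h0 : cutoff 0 y = 1 := by simp [cutoff, hy']
  rw [← h0]
  exact h.tendsto.mono_left nhdsWithin_le_nhds

lemma tendsto_cutoffSlope {y : E} (hy : y ≠ 0) :
    Tendsto (fun δ : ℝ => cutoffSlope δ y) (𝓝[>] 0) (𝓝 0) := by
  have h : ContinuousAt (fun δ : ℝ => cutoffSlope δ y) 0 := by
    unfold cutoffSlope
    exact ContinuousAt.div (by fun_prop) (by fun_prop) (by simpa using hy)
  have h0 : cutoffSlope 0 y = 0 := by simp [cutoffSlope]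
  have h1 := h.tendsto
  rw [h0] at h1
  exact h1.mono_left nhdsWithin_le_nhds

lemma continuous_cutoffSlope {δ : ℝ} (hδ : 0 < δ) : Continuous (cutoffSlope δ : E → ℝ) := by
  unfold cutoffSlope
  exact Continuous.div (by fun_prop) (by fun_prop) fun y => by positivity

variable [InnerProductSpace ℝ E]

lemma hasFDerivAt_norm_sq_real (y : E) :
    HasFDerivAt (fun y : E => ‖y‖ ^ 2) (2 • innerSL ℝ y) y :=
  (hasStrictFDerivAt_norm_sq y).hasFDerivAt

lemma hasFDerivAt_cutoff {δ : ℝ} (hδ : 0 < δ) (y : E) :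
    HasFDerivAt (cutoff δ) (cutoffSlope δ y • (2 • innerSL ℝ y)) y := by
  have hq : δ + ‖y‖ ^ 2 + δ * (‖y‖ ^ 2) ^ 2 ≠ 0 := by positivity
  have h : HasDerivAt (fun t : ℝ => t / (δ + t + δ * t ^ 2)) (cutoffSlope δ y) (‖y‖ ^ 2) := by
    have h1 : HasDerivAt (fun t : ℝ => δ + t + δ * t ^ 2) (1 + δ * (2 * ‖y‖ ^ 2)) (‖y‖ ^ 2) := by
      have := ((hasDerivAt_id (‖y‖ ^ 2)).const_add δ).add
        (((hasDerivAt_id (‖y‖ ^ 2)).pow 2).const_mul δ)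
      exact this.congr_deriv (by simp)
    refine ((hasDerivAt_id (‖y‖ ^ 2)).div h1 hq).congr_deriv ?_
    simp only [cutoffSlope, id]
    congr 1
    ring
  exact h.comp_hasFDerivAt y (hasFDerivAt_norm_sq_real y)

end Cutoff

section Divergence

variable {E : Type*} [NormedAddCommGroup E] [InnerProductSpace ℝ E] [FiniteDimensional ℝ E]
  [MeasurableSpace E] [BorelSpace E]

lemma integral_hasFDerivAt_eq_zero {G : E → ℝ} {G' : E → E →L[ℝ] ℝ} {c : E}
    (hG : ∀ y, HasFDerivAt G (G' y) y) (hGi : Integrable G) (hG'i : Integrable fun y => G' y c) :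
    ∫ y, G' y c = 0 := by
  have h := integral_bilinear_hasFDerivAt_right_eq_neg_left_of_integrable
    (μ := (volume : Measure E)) (f := fun _ : E => (1 : ℝ)) (f' := fun _ => 0) (g := G) (g' := G')
    (v := c) (B := ContinuousLinearMap.mul ℝ ℝ) (by simp) (by simpa using hG'i) (by simpa using hGi)
    (fun x _ => hasFDerivAt_const 1 x) (fun x _ => hG x)
  simpa using h

/-- The integral of a directional derivative vanishes, for a function that may be singular (but is
bounded) at the origin. -/
lemma integral_hasFDerivAt_eq_zero_of_punctured [Nontrivial E] {F : E → ℝ} {F' : E → E →L[ℝ] ℝ}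
    {c : E} {C : ℝ} (hF : ∀ y ≠ 0, HasFDerivAt F (F' y) y) (hFb : ∀ y ≠ 0, |F y| ≤ C)
    (hFi : Integrable fun y => F y * ‖y‖⁻¹) (hF'i : Integrable fun y => F' y c) :
    ∫ y, F' y c = 0 := by
  have hae : ∀ᵐ y : E, y ≠ 0 := by simp [ae_iff]
  set D : ℝ → E → E →L[ℝ] ℝ :=
    fun δ y => cutoff δ y • F' y + F y • (cutoffSlope δ y • (2 • innerSL ℝ y)) with hD
  have hDc : ∀ δ y, D δ y c =
      cutoff δ y * F' y c + (F y * ‖y‖⁻¹) * (cutoffSlope δ y * (2 * ⟪y, c⟫) * ‖y‖) := by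
    intro δ y
    rcases eq_or_ne y 0 with rfl | hy
    · simp [hD]
    · have : ‖y‖ ≠ 0 := by simpa using hy
      simp [hD]
      field_simp
  have hslope : ∀ δ > 0, ∀ y : E, |cutoffSlope δ y * (2 * ⟪y, c⟫) * ‖y‖| ≤ 2 * ‖c‖ := by
    intro δ hδ y
    have h1 := abs_cutoffSlope_mul_le hδ y
    have h2 := abs_real_inner_le_norm y c
    rw [abs_mul, abs_mul, abs_mul, abs_norm, abs_two]
    calc |cutoffSlope δ y| * (2 * |⟪y, c⟫|) * ‖y‖
        ≤ |cutoffSlope δ y| * (2 * (‖y‖ * ‖c‖)) * ‖y‖ := by gcongr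
      _ = (|cutoffSlope δ y| * ‖y‖ ^ 2) * (2 * ‖c‖) := by ring
      _ ≤ 1 * (2 * ‖c‖) := by gcongr
      _ = 2 * ‖c‖ := one_mul _
  have hbound : ∀ δ > 0, ∀ y, ‖D δ y c‖ ≤ |F' y c| + |F y * ‖y‖⁻¹| * (2 * ‖c‖) := by
    intro δ hδ y
    rw [hDc, Real.norm_eq_abs]
    refine (abs_add_le _ _).trans (add_le_add ?_ ?_)
    · rw [abs_mul, abs_of_nonneg (cutoff_nonneg hδ y)]
      exact mul_le_of_le_one_left (abs_nonneg _) (cutoff_le_one hδ y)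
    · rw [abs_mul]
      gcongr
      exact hslope δ hδ y
  have hmeas : ∀ δ > 0, AEStronglyMeasurable (fun y => D δ y c) volume := by
    intro δ hδ
    simp_rw [hDc]
    have h1 := (continuous_cutoff (E := E) hδ).aestronglyMeasurable (μ := volume)
    have h2 : Continuous fun y : E => cutoffSlope δ y * (2 * ⟪y, c⟫) * ‖y‖ := by
      have := continuous_cutoffSlope (E := E) hδ
      fun_prop
    exact (h1.mul hF'i.aestronglyMeasurable).add
      (hFi.aestronglyMeasurable.mul h2.aestronglyMeasurable)
  have hbi : Integrable fun y => |F' y c| + |F y * ‖y‖⁻¹| * (2 * ‖c‖) :=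
    hF'i.abs.add (hFi.abs.mul_const _)
  have hzero : ∀ δ > 0, ∫ y, D δ y c = 0 := by
    intro δ hδ
    refine integral_hasFDerivAt_eq_zero (G := fun y => cutoff δ y * F y) ?_ ?_
      (hbi.mono' (hmeas δ hδ) (Eventually.of_forall (hbound δ hδ)))
    · intro y
      rcases eq_or_ne y 0 with rfl | hy
      · have : D δ 0 = 0 := by simp [hD, cutoff]
        rw [this]
        refine HasFDerivAt.of_isLittleO ?_
        have hO : (fun y : E => cutoff δ y * F y) =O[𝓝 0] fun y => ‖y‖ ^ 2 := by
          refine Asymptotics.IsBigO.of_bound (δ⁻¹ * |C|) (Eventually.of_forall fun y => ?_)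
          rcases eq_or_ne y 0 with rfl | hy
          · simp [cutoff]
          rw [norm_mul, Real.norm_eq_abs, Real.norm_eq_abs, abs_of_nonneg (cutoff_nonneg hδ y),
            norm_pow, norm_norm]
          calc cutoff δ y * |F y| ≤ (δ⁻¹ * ‖y‖ ^ 2) * |C| :=
                mul_le_mul (cutoff_le_norm_sq hδ y) ((hFb y hy).trans (le_abs_self C))
                  (abs_nonneg _) (by positivity)
            _ = _ := by ring
        have ho : (fun y : E => ‖y‖ ^ 2) =o[𝓝 0] fun y : E => y := by
          simpa using Asymptotics.isLittleO_norm_pow_id (E' := E) one_lt_two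
        simpa [cutoff] using hO.trans_isLittleO ho
      · exact (hasFDerivAt_cutoff hδ y).mul (hF y hy) |>.congr_fderiv (by simp [hD])
    · have h : Integrable fun y => (‖y‖ * cutoff δ y) * (F y * ‖y‖⁻¹) := by
        refine hFi.bdd_mul (c := 1 + δ⁻¹) ?_ (Eventually.of_forall fun y => ?_)
        · exact (continuous_norm.mul (continuous_cutoff hδ)).aestronglyMeasurable
        · rw [Real.norm_eq_abs, abs_of_nonneg (mul_nonneg (norm_nonneg _) (cutoff_nonneg hδ y))]
          exact norm_mul_cutoff_le hδ y
      refine h.congr (hae.mono fun y hy => ?_)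
      have : ‖y‖ ≠ 0 := by simpa using hy
      field_simp
  have hlim : Tendsto (fun δ => ∫ y, D δ y c) (𝓝[>] 0) (𝓝 (∫ y, F' y c)) := by
    refine tendsto_integral_filter_of_dominated_convergence _
      (eventually_mem_nhdsWithin.mono fun δ hδ => hmeas δ hδ)
      (eventually_mem_nhdsWithin.mono fun δ hδ => Eventually.of_forall (hbound δ hδ)) hbi
      (hae.mono fun y hy => ?_)
    simp_rw [hDc]
    have h1 := (tendsto_cutoff hy).mul_const (F' y c)
    have h2 := (((tendsto_cutoffSlope hy).mul_const (2 * ⟪y, c⟫)).mul_const ‖y‖).const_mul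
      (F y * ‖y‖⁻¹)
    simpa using h1.add h2
  refine tendsto_nhds_unique hlim (Tendsto.congr' ?_ tendsto_const_nhds)
  exact eventually_mem_nhdsWithin.mono fun δ hδ => (hzero δ hδ).symm

end Divergence

section Kernel

variable {E : Type*} [NormedAddCommGroup E] [InnerProductSpace ℝ E]

/-- The Hessian `D²Γ(a, b)` of the regularized fundamental solution with
`∇Γ(z) = (‖z‖ ^ 2 + ε ^ 2) ^ (-m / 2) • z`. -/
noncomputable def kernelHess (m : ℕ) (ε : ℝ) (z a b : E) : ℝ :=
  (‖z‖ ^ 2 + ε ^ 2) ^ (-(m : ℝ) / 2) * ⟪a, b⟫ -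
    m * (‖z‖ ^ 2 + ε ^ 2) ^ (-(m : ℝ) / 2 - 1) * (⟪z, a⟫ * ⟪z, b⟫)

/-- The third derivative of the regularized fundamental solution. -/
noncomputable def kernelThird (m : ℕ) (ε : ℝ) (z a b : E) : E →L[ℝ] ℝ :=
  (-(m * (‖z‖ ^ 2 + ε ^ 2) ^ (-(m : ℝ) / 2 - 1))) •
      (⟪a, b⟫ • innerSL ℝ z + ⟪z, b⟫ • innerSL ℝ a + ⟪z, a⟫ • innerSL ℝ b) +
    (m * (m + 2) * (‖z‖ ^ 2 + ε ^ 2) ^ (-(m : ℝ) / 2 - 2) * (⟪z, a⟫ * ⟪z, b⟫)) • innerSL ℝ z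

lemma hasFDerivAt_bracket_rpow {ε : ℝ} (hε : 0 < ε) (r : ℝ) (z : E) :
    HasFDerivAt (fun z : E => (‖z‖ ^ 2 + ε ^ 2) ^ r)
      ((2 * r * (‖z‖ ^ 2 + ε ^ 2) ^ (r - 1)) • innerSL ℝ z) z := by
  have h := ((hasFDerivAt_norm_sq_real z).add_const (ε ^ 2)).rpow_const (p := r)
    (Or.inl (by positivity))
  refine h.congr_fderiv ?_
  ext c
  simp
  ring

lemma hasFDerivAt_kernelHess {ε : ℝ} (hε : 0 < ε) (m : ℕ) (z a b : E) :
    HasFDerivAt (fun z => kernelHess m ε z a b) (kernelThird m ε z a b) z := by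
  have h1 := (hasFDerivAt_bracket_rpow hε (-(m : ℝ) / 2) z).mul_const ⟪a, b⟫
  have h2 := (hasFDerivAt_bracket_rpow hε (-(m : ℝ) / 2 - 1) z).const_mul (m : ℝ)
  have h3 : ∀ a : E, HasFDerivAt (fun z : E => ⟪z, a⟫) (innerSL ℝ a) z := fun a => by
    simpa [real_inner_comm] using (innerSL ℝ a).hasFDerivAt (x := z)
  refine (h1.sub (h2.mul ((h3 a).mul (h3 b)))).congr_fderiv ?_
  ext c
  have : (-(m : ℝ) / 2 - 1 - 1) = -(m : ℝ) / 2 - 2 := by ring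
  simp [kernelThird, this]
  ring

lemma kernelThird_comm (m : ℕ) (ε : ℝ) (z a b : E) :
    kernelThird m ε z a b = kernelThird m ε z b a := by
  ext c
  simp [kernelThird, real_inner_comm b a]
  ring

lemma kernelThird_comm_right (m : ℕ) (ε : ℝ) (z a b c : E) :
    kernelThird m ε z a b c = kernelThird m ε z a c b := by
  simp [kernelThird, real_inner_comm c b]
  ring

omit [InnerProductSpace ℝ E] in
lemma bracket_rpow_mul_norm_le {ε : ℝ} (hε : 0 < ε) (r : ℝ) (k : ℕ) (z : E) :
    (‖z‖ ^ 2 + ε ^ 2) ^ (r - k / 2) * ‖z‖ ^ k ≤ (‖z‖ ^ 2 + ε ^ 2) ^ r := by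
  have hσ : 0 < ‖z‖ ^ 2 + ε ^ 2 := by positivity
  have h : ‖z‖ ^ k ≤ (‖z‖ ^ 2 + ε ^ 2) ^ ((k : ℝ) / 2) := by
    rw [div_eq_inv_mul, Real.rpow_mul hσ.le, Real.rpow_natCast, ← one_div, ← Real.sqrt_eq_rpow]
    gcongr
    exact Real.le_sqrt_of_sq_le (by nlinarith)
  calc _ ≤ (‖z‖ ^ 2 + ε ^ 2) ^ (r - k / 2) * (‖z‖ ^ 2 + ε ^ 2) ^ ((k : ℝ) / 2) := by gcongr
    _ = _ := by rw [← Real.rpow_add hσ]; ring_nf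

lemma abs_kernelHess_le {ε : ℝ} (hε : 0 < ε) (m : ℕ) (z a b : E) :
    |kernelHess m ε z a b| ≤ (1 + m) * (‖a‖ * ‖b‖) * (‖z‖ ^ 2 + ε ^ 2) ^ (-(m : ℝ) / 2) := by
  have h2 := bracket_rpow_mul_norm_le hε (-(m : ℝ) / 2) 2 z
  norm_num at h2
  have hσ : 0 < ‖z‖ ^ 2 + ε ^ 2 := by positivity
  have hp := Real.rpow_nonneg hσ.le (-(m : ℝ) / 2)
  have hp2 := Real.rpow_nonneg hσ.le (-(m : ℝ) / 2 - 1)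
  unfold kernelHess
  refine (abs_sub _ _).trans ?_
  simp only [abs_mul, abs_of_nonneg hp, abs_of_nonneg hp2, Nat.abs_cast]
  calc _ ≤ (‖z‖ ^ 2 + ε ^ 2) ^ (-(m : ℝ) / 2) * (‖a‖ * ‖b‖) +
        m * (‖z‖ ^ 2 + ε ^ 2) ^ (-(m : ℝ) / 2 - 1) * ((‖z‖ * ‖a‖) * (‖z‖ * ‖b‖)) := by
        gcongr <;> exact abs_real_inner_le_norm _ _
    _ = (‖z‖ ^ 2 + ε ^ 2) ^ (-(m : ℝ) / 2) * (‖a‖ * ‖b‖) + m * (‖a‖ * ‖b‖) *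
        ((‖z‖ ^ 2 + ε ^ 2) ^ (-(m : ℝ) / 2 - 1) * ‖z‖ ^ 2) := by ring
    _ ≤ (‖z‖ ^ 2 + ε ^ 2) ^ (-(m : ℝ) / 2) * (‖a‖ * ‖b‖) + m * (‖a‖ * ‖b‖) *
        ((‖z‖ ^ 2 + ε ^ 2) ^ (-(m : ℝ) / 2)) := by gcongr
    _ = _ := by ring

lemma abs_kernelThird_le {ε : ℝ} (hε : 0 < ε) (m : ℕ) (z a b c : E) :
    |kernelThird m ε z a b c| ≤ (3 * m + m * (m + 2)) * (‖a‖ * ‖b‖ * ‖c‖) *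
      (‖z‖ ^ 2 + ε ^ 2) ^ (-(m : ℝ) / 2 - 1 / 2) := by
  have h1 := bracket_rpow_mul_norm_le hε (-(m : ℝ) / 2 - 1 / 2) 1 z
  have h3 := bracket_rpow_mul_norm_le hε (-(m : ℝ) / 2 - 1 / 2) 3 z
  rw [show -(m : ℝ) / 2 - 1 / 2 - (1 : ℕ) / 2 = -(m : ℝ) / 2 - 1 by push_cast; ring, pow_one] at h1
  rw [show -(m : ℝ) / 2 - 1 / 2 - (3 : ℕ) / 2 = -(m : ℝ) / 2 - 2 by push_cast; ring] at h3
  have hσ : 0 < ‖z‖ ^ 2 + ε ^ 2 := by positivity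
  have hp1 := Real.rpow_nonneg hσ.le (-(m : ℝ) / 2 - 1)
  have hp2 := Real.rpow_nonneg hσ.le (-(m : ℝ) / 2 - 2)
  have hm : (0 : ℝ) ≤ m + 2 := by positivity
  have habs : |kernelThird m ε z a b c| ≤ m * (‖z‖ ^ 2 + ε ^ 2) ^ (-(m : ℝ) / 2 - 1) *
      (|⟪a, b⟫| * |⟪z, c⟫| + |⟪z, b⟫| * |⟪a, c⟫| + |⟪z, a⟫| * |⟪b, c⟫|) +
      m * (m + 2) * (‖z‖ ^ 2 + ε ^ 2) ^ (-(m : ℝ) / 2 - 2) * (|⟪z, a⟫| * |⟪z, b⟫|) * |⟪z, c⟫| := by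
    simp only [kernelThird, add_apply, smul_apply, innerSL_apply_apply, smul_eq_mul]
    refine (abs_add_le _ _).trans (add_le_add ?_ ?_)
    · rw [abs_mul, abs_neg, abs_mul, abs_of_nonneg hp1, Nat.abs_cast]
      gcongr
      refine (abs_add_three _ _ _).trans ?_
      simp only [abs_mul, le_refl]
    · simp only [abs_mul, abs_of_nonneg hp2, Nat.abs_cast, abs_of_nonneg hm, le_refl]
  refine habs.trans ?_
  calc _ ≤ m * (‖z‖ ^ 2 + ε ^ 2) ^ (-(m : ℝ) / 2 - 1) *
      ((‖a‖ * ‖b‖) * (‖z‖ * ‖c‖) + (‖z‖ * ‖b‖) * (‖a‖ * ‖c‖) + (‖z‖ * ‖a‖) * (‖b‖ * ‖c‖)) +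
      m * (m + 2) * (‖z‖ ^ 2 + ε ^ 2) ^ (-(m : ℝ) / 2 - 2) * ((‖z‖ * ‖a‖) * (‖z‖ * ‖b‖)) *
        (‖z‖ * ‖c‖) := by
        gcongr <;> exact abs_real_inner_le_norm _ _
    _ = 3 * m * (‖a‖ * ‖b‖ * ‖c‖) * ((‖z‖ ^ 2 + ε ^ 2) ^ (-(m : ℝ) / 2 - 1) * ‖z‖) +
      m * (m + 2) * (‖a‖ * ‖b‖ * ‖c‖) * ((‖z‖ ^ 2 + ε ^ 2) ^ (-(m : ℝ) / 2 - 2) * ‖z‖ ^ 3) := by ring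
    _ ≤ 3 * m * (‖a‖ * ‖b‖ * ‖c‖) * (‖z‖ ^ 2 + ε ^ 2) ^ (-(m : ℝ) / 2 - 1 / 2) +
      m * (m + 2) * (‖a‖ * ‖b‖ * ‖c‖) * (‖z‖ ^ 2 + ε ^ 2) ^ (-(m : ℝ) / 2 - 1 / 2) := by gcongr
    _ = _ := by ring

/-- Sharp bound on the diagonal of the Hessian kernel by its homogeneous counterpart. -/
lemma abs_kernelHess_self_le {ε : ℝ} (hε : 0 < ε) {n : ℕ} (hn : 1 ≤ n) {z : E} (hz : z ≠ 0) {a : E}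
    (ha : ‖a‖ = 1) : |kernelHess (n + 1) ε z a a| ≤ n * (‖z‖ ^ (n + 1))⁻¹ := by
  have hσ : 0 < ‖z‖ ^ 2 + ε ^ 2 := by positivity
  have hz' : 0 < ‖z‖ := by positivity
  have h2 := bracket_rpow_mul_norm_le hε (-((n + 1 : ℕ) : ℝ) / 2) 2 z
  rw [show -((n + 1 : ℕ) : ℝ) / 2 - (2 : ℕ) / 2 = -((n + 1 : ℕ) : ℝ) / 2 - 1 by
    push_cast; ring] at h2
  have hle : (‖z‖ ^ 2 + ε ^ 2) ^ (-((n + 1 : ℕ) : ℝ) / 2) ≤ (‖z‖ ^ (n + 1))⁻¹ := by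
    have h0 := bracket_rpow_mul_norm_le hε 0 (n + 1) z
    rw [Real.rpow_zero, zero_sub, ← neg_div] at h0
    rwa [← one_div, le_div_iff₀ (by positivity)]
  have hin : ⟪z, a⟫ * ⟪z, a⟫ ≤ ‖z‖ ^ 2 := by
    have := abs_real_inner_le_norm z a
    rw [ha, mul_one] at this
    nlinarith [abs_mul_abs_self ⟪z, a⟫, abs_nonneg ⟪z, a⟫]
  have hin0 : 0 ≤ ⟪z, a⟫ * ⟪z, a⟫ := mul_self_nonneg _
  have hp := Real.rpow_nonneg hσ.le (-((n + 1 : ℕ) : ℝ) / 2)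
  have hp2 := Real.rpow_nonneg hσ.le (-((n + 1 : ℕ) : ℝ) / 2 - 1)
  have hn' : (1 : ℝ) ≤ n := by exact_mod_cast hn
  unfold kernelHess
  rw [real_inner_self_eq_norm_sq, ha]
  set p := (‖z‖ ^ 2 + ε ^ 2) ^ (-((n + 1 : ℕ) : ℝ) / 2)
  set p2 := (‖z‖ ^ 2 + ε ^ 2) ^ (-((n + 1 : ℕ) : ℝ) / 2 - 1)
  have h3 : p2 * (⟪z, a⟫ * ⟪z, a⟫) ≤ p := (mul_le_mul_of_nonneg_left hin hp2).trans h2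
  have h4 : 0 ≤ p2 * (⟪z, a⟫ * ⟪z, a⟫) := mul_nonneg hp2 hin0
  refine le_trans ?_ (mul_le_mul_of_nonneg_left hle (by positivity : (0 : ℝ) ≤ n))
  push_cast
  rw [abs_le]
  constructor <;> nlinarith

lemma sum_kernelHess_self {ι : Type*} [Fintype ι] (b : OrthonormalBasis ι ℝ E) {ε : ℝ} (hε : 0 < ε)
    (z : E) : ∑ i, kernelHess (Fintype.card ι) ε z (b i) (b i) =
      Fintype.card ι * ε ^ 2 * (‖z‖ ^ 2 + ε ^ 2) ^ (-(Fintype.card ι : ℝ) / 2 - 1) := by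
  have hσ : 0 < ‖z‖ ^ 2 + ε ^ 2 := by positivity
  have hs : ∑ i, ⟪z, b i⟫ * ⟪z, b i⟫ = ‖z‖ ^ 2 := by
    have := b.sum_inner_mul_inner z z
    simpa [real_inner_comm z] using this
  simp only [kernelHess, Finset.sum_sub_distrib, ← Finset.mul_sum, hs, Real.rpow_sub_one hσ.ne',
    real_inner_self_eq_norm_sq, b.norm_eq_one]
  simp
  field_simp
  ring

end Kernel

section Decay

variable {E : Type*} [NormedAddCommGroup E]

/-- The integrable weight dominating all integrands in the representation formula. -/
noncomputable def weight (m : ℕ) (y : E) : ℝ :=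
  (1 + ‖y‖ ^ 2) ^ (-(m : ℝ) / 2) * ‖y‖⁻¹

lemma one_add_norm_sq_le_bracket {e : E} (he : ‖e‖ = 1) {ε : ℝ} (hε : 0 < ε) (y : E) :
    (2 + 3 / ε ^ 2)⁻¹ * (1 + ‖y‖ ^ 2) ≤ ‖y - e‖ ^ 2 + ε ^ 2 := by
  rw [inv_mul_le_iff₀ (by positivity)]
  have h : ‖y‖ ≤ ‖y - e‖ + 1 := by
    have := norm_add_le (y - e) e
    rwa [sub_add_cancel, he] at this
  have h2 : (2 + 3 / ε ^ 2) * (‖y - e‖ ^ 2 + ε ^ 2) =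
      2 * ‖y - e‖ ^ 2 + 3 + (2 * ε ^ 2 + 3 / ε ^ 2 * ‖y - e‖ ^ 2) := by
    field_simp; ring
  have h3 : 0 ≤ 2 * ε ^ 2 + 3 / ε ^ 2 * ‖y - e‖ ^ 2 := by positivity
  rw [h2]
  nlinarith [norm_nonneg y, norm_nonneg (y - e), sq_nonneg (‖y - e‖ - 1)]

lemma bracket_rpow_neg_le {e : E} (he : ‖e‖ = 1) {ε : ℝ} (hε : 0 < ε) {r : ℝ} (hr : r ≤ 0) (y : E) :
    (‖y - e‖ ^ 2 + ε ^ 2) ^ r ≤ ((2 + 3 / ε ^ 2)⁻¹) ^ r * (1 + ‖y‖ ^ 2) ^ r := by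
  rw [← Real.mul_rpow (by positivity) (by positivity)]
  exact Real.rpow_le_rpow_of_nonpos (by positivity) (one_add_norm_sq_le_bracket he hε y) hr

lemma one_add_norm_sq_rpow_le_weight (m : ℕ) {y : E} (hy : y ≠ 0) :
    (1 + ‖y‖ ^ 2) ^ (-(m : ℝ) / 2 - 1 / 2) ≤ weight m y := by
  have h := bracket_rpow_mul_norm_le one_pos (-(m : ℝ) / 2) 1 y
  simp only [Nat.cast_one, pow_one, one_pow, add_comm _ (1 : ℝ)] at h
  rw [weight, ← div_eq_mul_inv, le_div_iff₀ (by positivity)]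
  exact h

variable [NormedSpace ℝ E] [FiniteDimensional ℝ E] [MeasurableSpace E] [BorelSpace E]

lemma integrable_weight {m : ℕ} (hm : 2 ≤ m) (hE : finrank ℝ E = m) (μ : Measure E)
    [μ.IsAddHaarMeasure] : Integrable (weight m : E → ℝ) μ := by
  have : Nontrivial E := Module.nontrivial_of_finrank_pos (R := ℝ) (by omega)
  refine (integrable_fun_norm_addHaar μ
    (f := fun r : ℝ => (1 + r ^ 2) ^ (-(m : ℝ) / 2) * r⁻¹)).2 ?_
  refine Integrable.mono' (g := fun r : ℝ => (1 + r ^ 2)⁻¹) integrable_inv_one_add_sq.integrableOn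
    ?_ ?_
  · refine ContinuousOn.aestronglyMeasurable ?_ measurableSet_Ioi
    have h1 : Continuous fun r : ℝ => (1 + r ^ 2) ^ (-(m : ℝ) / 2) :=
      Continuous.rpow_const (by fun_prop) fun r => Or.inl (by positivity)
    exact (continuous_pow _).continuousOn.smul
      (h1.continuousOn.mul (continuousOn_inv₀.mono fun r (hr : 0 < r) => hr.ne'))
  · refine (ae_restrict_mem measurableSet_Ioi).mono fun r (hr : 0 < r) => ?_
    obtain ⟨k, rfl⟩ : ∃ k, m = k + 2 := ⟨m - 2, by omega⟩
    rw [hE, show k + 2 - 1 = k + 1 by omega, smul_eq_mul, Real.norm_of_nonneg (by positivity)]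
    have h := bracket_rpow_mul_norm_le one_pos (-1) k r
    rw [Real.rpow_neg_one, Real.norm_of_nonneg hr.le, one_pow, add_comm _ (1 : ℝ),
      show -1 - (k : ℝ) / 2 = -((k + 2 : ℕ) : ℝ) / 2 by push_cast; ring] at h
    calc _ = (1 + r ^ 2) ^ (-((k + 2 : ℕ) : ℝ) / 2) * r ^ k := by field_simp; ring
      _ ≤ _ := h

end Decay

section HomBounds

variable {E : Type*} [NormedAddCommGroup E] [NormedSpace ℝ E]

/-- The derivative bounds satisfied by functions homogeneous of degree `1` that are `C²` away from
the origin. -/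
structure HomBounds (v : E → ℝ) (C : ℝ) : Prop where
  contDiffOn : ContDiffOn ℝ 2 v {0}ᶜ
  norm_fderiv_le : ∀ y ≠ 0, ‖fderiv ℝ v y‖ ≤ C
  norm_fderiv_fderiv_le : ∀ y ≠ 0, ‖fderiv ℝ (fderiv ℝ v) y‖ ≤ C * ‖y‖⁻¹

variable {v : E → ℝ} {C : ℝ}

lemma HomBounds.contDiffAt (hv : HomBounds v C) {y : E} (hy : y ≠ 0) : ContDiffAt ℝ 2 v y :=
  hv.contDiffOn.contDiffAt (isOpen_compl_singleton.mem_nhds hy)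

lemma HomBounds.nonneg (hv : HomBounds v C) [Nontrivial E] : 0 ≤ C := by
  obtain ⟨y, hy⟩ := exists_ne (0 : E)
  exact (norm_nonneg _).trans (hv.norm_fderiv_le y hy)

lemma HomBounds.hasFDerivAt_fderiv (hv : HomBounds v C) {y : E} (hy : y ≠ 0) :
    HasFDerivAt (fderiv ℝ v) (fderiv ℝ (fderiv ℝ v) y) y :=
  (((hv.contDiffAt hy).fderiv_right (m := 1) (by norm_num)).differentiableAt one_ne_zero).hasFDerivAt

lemma HomBounds.symm (hv : HomBounds v C) {y : E} (hy : y ≠ 0) (a b : E) :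
    fderiv ℝ (fderiv ℝ v) y a b = fderiv ℝ (fderiv ℝ v) y b a :=
  (hv.contDiffAt hy).isSymmSndFDerivAt (by simp) a b

lemma HomBounds.abs_fderiv_le (hv : HomBounds v C) {y : E} (hy : y ≠ 0) (b : E) :
    |fderiv ℝ v y b| ≤ C * ‖b‖ :=
  (fderiv ℝ v y).le_of_opNorm_le (hv.norm_fderiv_le y hy) b

lemma HomBounds.abs_fderiv_fderiv_le (hv : HomBounds v C) {y : E} (hy : y ≠ 0) (a b : E) :
    |fderiv ℝ (fderiv ℝ v) y a b| ≤ C * ‖y‖⁻¹ * ‖a‖ * ‖b‖ :=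
  ((fderiv ℝ (fderiv ℝ v) y).le_opNorm₂ a b).trans (by
    gcongr
    exact hv.norm_fderiv_fderiv_le y hy)

lemma HomBounds.continuousAt_second (hv : HomBounds v C) {y : E} (hy : y ≠ 0) (a b : E) :
    ContinuousAt (fun y => fderiv ℝ (fderiv ℝ v) y a b) y := by
  have h := (((hv.contDiffAt hy).fderiv_right (m := 1) (by norm_num)).fderiv_right (m := 0)
    (by norm_num)).continuousAt
  exact (h.clm_apply continuousAt_const).clm_apply continuousAt_const

variable [MeasurableSpace E] [BorelSpace E]

lemma measurable_fderiv_fderiv_apply (v : E → ℝ) (a b : E) :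
    Measurable fun y => fderiv ℝ (fderiv ℝ v) y a b := by
  have h : Measurable fun y => fderiv ℝ (fderiv ℝ v) y a := measurable_fderiv_apply_const ℝ _ a
  exact h.apply_continuousLinearMap b

end HomBounds

section Swap

variable {E : Type*} [NormedAddCommGroup E] [InnerProductSpace ℝ E] [FiniteDimensional ℝ E]
  [MeasurableSpace E] [BorelSpace E]

variable {v : E → ℝ} {C : ℝ} {m : ℕ} {ε : ℝ} {e : E}

lemma HomBounds.integrable_second_mul (hv : HomBounds v C) (hm : 2 ≤ m) (hE : finrank ℝ E = m)
    (hε : 0 < ε) (he : ‖e‖ = 1) (a b p q : E) :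
    Integrable fun y => fderiv ℝ (fderiv ℝ v) y a b * kernelHess m ε (y - e) p q := by
  have : Nontrivial E := Module.nontrivial_of_finrank_pos (R := ℝ) (by omega)
  have hC := hv.nonneg
  have hae : ∀ᵐ y : E, y ≠ 0 := by simp [ae_iff]
  have hk : Continuous fun z => kernelHess m ε z p q :=
    continuous_iff_continuousAt.2 fun z => (hasFDerivAt_kernelHess hε m z p q).continuousAt
  refine Integrable.mono' ((integrable_weight hm hE volume).const_mul
    (C * ‖a‖ * ‖b‖ * ((1 + m) * (‖p‖ * ‖q‖) * ((2 + 3 / ε ^ 2)⁻¹) ^ (-(m : ℝ) / 2)))) ?_ ?_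
  · exact ((measurable_fderiv_fderiv_apply v a b).mul
      (hk.comp (continuous_sub_right e)).measurable).aestronglyMeasurable
  · refine hae.mono fun y hy => ?_
    rw [norm_mul]
    have h1 := bracket_rpow_neg_le he hε
      (show -(m : ℝ) / 2 ≤ 0 by have : (0 : ℝ) ≤ m := by positivity
                                linarith) y
    calc _ ≤ (C * ‖y‖⁻¹ * ‖a‖ * ‖b‖) *
          ((1 + m) * (‖p‖ * ‖q‖) * (‖y - e‖ ^ 2 + ε ^ 2) ^ (-(m : ℝ) / 2)) :=
          mul_le_mul (hv.abs_fderiv_fderiv_le hy a b) (abs_kernelHess_le hε m _ p q)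
            (abs_nonneg _) (by positivity)
      _ ≤ (C * ‖y‖⁻¹ * ‖a‖ * ‖b‖) * ((1 + m) * (‖p‖ * ‖q‖) *
          (((2 + 3 / ε ^ 2)⁻¹) ^ (-(m : ℝ) / 2) * (1 + ‖y‖ ^ 2) ^ (-(m : ℝ) / 2))) := by gcongr
      _ = _ := by rw [weight]; ring

lemma HomBounds.integrable_first_mul (hv : HomBounds v C) (hm : 2 ≤ m) (hE : finrank ℝ E = m)
    (hε : 0 < ε) (he : ‖e‖ = 1) (b p q c : E) :
    Integrable fun y => fderiv ℝ v y b * kernelThird m ε (y - e) p q c := by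
  have : Nontrivial E := Module.nontrivial_of_finrank_pos (R := ℝ) (by omega)
  have hC := hv.nonneg
  have hae : ∀ᵐ y : E, y ≠ 0 := by simp [ae_iff]
  have hk : Measurable fun z => kernelThird m ε z p q c := by
    have h : (fun z => kernelThird m ε z p q c) =
        fun z => fderiv ℝ (fun z => kernelHess m ε z p q) z c := by
      ext z
      rw [(hasFDerivAt_kernelHess hε m z p q).fderiv]
    rw [h]
    exact measurable_fderiv_apply_const ℝ _ c
  refine Integrable.mono' ((integrable_weight hm hE volume).const_mul
    (C * ‖b‖ * ((3 * m + m * (m + 2)) * (‖p‖ * ‖q‖ * ‖c‖) *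
      ((2 + 3 / ε ^ 2)⁻¹) ^ (-(m : ℝ) / 2 - 1 / 2)))) ?_ ?_
  · exact ((measurable_fderiv_apply_const ℝ v b).mul
      (hk.comp (measurable_sub_const e))).aestronglyMeasurable
  · refine hae.mono fun y hy => ?_
    rw [norm_mul]
    have h1 := bracket_rpow_neg_le he hε
      (show -(m : ℝ) / 2 - 1 / 2 ≤ 0 by have : (0 : ℝ) ≤ m := by positivity
                                        linarith) y
    have h2 := one_add_norm_sq_rpow_le_weight m hy
    calc _ ≤ (C * ‖b‖) * ((3 * m + m * (m + 2)) * (‖p‖ * ‖q‖ * ‖c‖) *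
            (‖y - e‖ ^ 2 + ε ^ 2) ^ (-(m : ℝ) / 2 - 1 / 2)) :=
          mul_le_mul (hv.abs_fderiv_le hy b) (abs_kernelThird_le hε m _ p q c)
            (abs_nonneg _) (by positivity)
      _ ≤ (C * ‖b‖) * ((3 * m + m * (m + 2)) * (‖p‖ * ‖q‖ * ‖c‖) *
            (((2 + 3 / ε ^ 2)⁻¹) ^ (-(m : ℝ) / 2 - 1 / 2) * weight m y)) := by
          gcongr
          exact h1.trans (by gcongr)
      _ = _ := by ring

lemma HomBounds.integral_add_eq_zero (hv : HomBounds v C) (hm : 2 ≤ m) (hE : finrank ℝ E = m)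
    (hε : 0 < ε) (he : ‖e‖ = 1) (c b p q : E) :
    ∫ y, (fderiv ℝ (fderiv ℝ v) y c b * kernelHess m ε (y - e) p q +
      fderiv ℝ v y b * kernelThird m ε (y - e) p q c) = 0 := by
  have : Nontrivial E := Module.nontrivial_of_finrank_pos (R := ℝ) (by omega)
  have hC := hv.nonneg
  have hae : ∀ᵐ y : E, y ≠ 0 := by simp [ae_iff]
  have hm0 : (0 : ℝ) ≤ m := by positivity
  have hr : -(m : ℝ) / 2 ≤ 0 := by linarith
  have hk : ∀ y, HasFDerivAt (fun y => kernelHess m ε (y - e) p q)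
      (kernelThird m ε (y - e) p q) y := fun y => by
    exact ((hasFDerivAt_kernelHess hε m (y - e) p q).comp y
      ((hasFDerivAt_id y).sub_const e)).congr_fderiv (ContinuousLinearMap.comp_id _)
  set F' : E → E →L[ℝ] ℝ := fun y => fderiv ℝ v y b • kernelThird m ε (y - e) p q +
    kernelHess m ε (y - e) p q • (fderiv ℝ (fderiv ℝ v) y).flip b with hF'
  have hF'c : ∀ y, F' y c = fderiv ℝ (fderiv ℝ v) y c b * kernelHess m ε (y - e) p q +
      fderiv ℝ v y b * kernelThird m ε (y - e) p q c := fun y => by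
    simp [hF']; ring
  have hb : ∀ y ≠ 0, |fderiv ℝ v y b * kernelHess m ε (y - e) p q| ≤
      C * ‖b‖ * ((1 + m) * (‖p‖ * ‖q‖) * ((2 + 3 / ε ^ 2)⁻¹) ^ (-(m : ℝ) / 2)) *
        (1 + ‖y‖ ^ 2) ^ (-(m : ℝ) / 2) := by
    intro y hy
    rw [abs_mul]
    calc _ ≤ (C * ‖b‖) *
          ((1 + m) * (‖p‖ * ‖q‖) * (‖y - e‖ ^ 2 + ε ^ 2) ^ (-(m : ℝ) / 2)) :=
          mul_le_mul (hv.abs_fderiv_le hy b) (abs_kernelHess_le hε m _ p q)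
            (abs_nonneg _) (by positivity)
      _ ≤ (C * ‖b‖) * ((1 + m) * (‖p‖ * ‖q‖) *
          (((2 + 3 / ε ^ 2)⁻¹) ^ (-(m : ℝ) / 2) * (1 + ‖y‖ ^ 2) ^ (-(m : ℝ) / 2))) := by
          gcongr
          exact bracket_rpow_neg_le he hε hr y
      _ = _ := by ring
  simp_rw [← hF'c]
  refine integral_hasFDerivAt_eq_zero_of_punctured (F := fun y =>
    fderiv ℝ v y b * kernelHess m ε (y - e) p q)
    (C := C * ‖b‖ * ((1 + m) * (‖p‖ * ‖q‖) * ((2 + 3 / ε ^ 2)⁻¹) ^ (-(m : ℝ) / 2))) ?_ ?_ ?_ ?_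
  · intro y hy
    have h1 := (hv.hasFDerivAt_fderiv hy).clm_apply (hasFDerivAt_const b y)
    refine (h1.mul (hk y)).congr_fderiv ?_
    ext x
    simp [hF']
  · intro y hy
    refine (hb y hy).trans (mul_le_of_le_one_right (by positivity) ?_)
    exact Real.rpow_le_one_of_one_le_of_nonpos (by nlinarith [sq_nonneg ‖y‖]) hr
  · refine Integrable.mono' ((integrable_weight hm hE volume).const_mul
      (C * ‖b‖ * ((1 + m) * (‖p‖ * ‖q‖) * ((2 + 3 / ε ^ 2)⁻¹) ^ (-(m : ℝ) / 2)))) ?_ ?_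
    · have h1 : Continuous fun y => kernelHess m ε (y - e) p q :=
        continuous_iff_continuousAt.2 fun y => (hk y).continuousAt
      exact (((measurable_fderiv_apply_const ℝ v b).mul h1.measurable).mul
        measurable_norm.inv).aestronglyMeasurable
    · refine hae.mono fun y hy => ?_
      rw [norm_mul, norm_inv, norm_norm, weight, ← mul_assoc]
      gcongr
      exact hb y hy
  · simp_rw [hF'c]
    exact (hv.integrable_second_mul hm hE hε he c b p q).add
      (hv.integrable_first_mul hm hE hε he b p q c)

/-- Moving two derivatives from the second derivatives of `v` onto the kernel and back. -/
lemma HomBounds.integral_swap (hv : HomBounds v C) (hm : 2 ≤ m) (hE : finrank ℝ E = m)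
    (hε : 0 < ε) (he : ‖e‖ = 1) (a ξ : E) :
    ∫ y, fderiv ℝ (fderiv ℝ v) y ξ ξ * kernelHess m ε (y - e) a a =
      ∫ y, fderiv ℝ (fderiv ℝ v) y a a * kernelHess m ε (y - e) ξ ξ := by
  have : Nontrivial E := Module.nontrivial_of_finrank_pos (R := ℝ) (by omega)
  have hae : ∀ᵐ y : E, y ≠ 0 := by simp [ae_iff]
  have key : ∀ c b p q, ∫ y, fderiv ℝ (fderiv ℝ v) y c b * kernelHess m ε (y - e) p q =
      - ∫ y, fderiv ℝ v y b * kernelThird m ε (y - e) p q c := fun c b p q => by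
    rw [eq_neg_iff_add_eq_zero, ← integral_add (hv.integrable_second_mul hm hE hε he c b p q)
      (hv.integrable_first_mul hm hE hε he b p q c)]
    exact hv.integral_add_eq_zero hm hE hε he c b p q
  have hs : ∫ y, fderiv ℝ (fderiv ℝ v) y a ξ * kernelHess m ε (y - e) a ξ =
      ∫ y, fderiv ℝ (fderiv ℝ v) y ξ a * kernelHess m ε (y - e) a ξ :=
    integral_congr_ae (hae.mono fun y hy => by simp only [hv.symm hy a ξ])
  rw [key ξ ξ a a, key a a ξ ξ]
  rw [key a ξ a ξ, key ξ a a ξ] at hs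
  have h1 : ∀ y, kernelThird m ε (y - e) a ξ a = kernelThird m ε (y - e) a a ξ := fun y =>
    kernelThird_comm_right _ _ _ _ _ _
  have h2 : ∀ y, kernelThird m ε (y - e) a ξ ξ = kernelThird m ε (y - e) ξ ξ a := fun y => by
    rw [kernelThird_comm, kernelThird_comm_right]
  simp_rw [h1, h2] at hs
  exact hs

lemma HomBounds.integral_second_mul_eq {ι : Type*} [Fintype ι] (β : OrthonormalBasis ι ℝ E)
    (hv : HomBounds v C) (hm : 2 ≤ Fintype.card ι) (hε : 0 < ε) (he : ‖e‖ = 1) (ξ : E) :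
    ∫ y, fderiv ℝ (fderiv ℝ v) y ξ ξ * (Fintype.card ι * ε ^ 2 *
        (‖y - e‖ ^ 2 + ε ^ 2) ^ (-(Fintype.card ι : ℝ) / 2 - 1)) =
      ∫ y, (∑ i, fderiv ℝ (fderiv ℝ v) y (β i) (β i)) *
        kernelHess (Fintype.card ι) ε (y - e) ξ ξ := by
  have hE : finrank ℝ E = Fintype.card ι := finrank_eq_card_basis β.toBasis
  simp_rw [← sum_kernelHess_self β hε, Finset.mul_sum, Finset.sum_mul]
  rw [integral_finsetSum _ fun i _ => hv.integrable_second_mul hm hE hε he _ _ _ _,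
    integral_finsetSum _ fun i _ => hv.integrable_second_mul hm hE hε he _ _ _ _]
  exact Finset.sum_congr rfl fun i _ => hv.integral_swap hm hE hε he _ _

end Swap

section Mollifier

lemma hasDerivAt_radial_primitive {m : ℕ} (hm : 1 ≤ m) (r : ℝ) :
    HasDerivAt (fun r : ℝ => r ^ m * (r ^ 2 + 1) ^ (-(m : ℝ) / 2))
      (r ^ (m - 1) * (m * (r ^ 2 + 1) ^ (-(m : ℝ) / 2 - 1))) r := by
  have h0 : (0 : ℝ) < r ^ 2 + 1 := by positivity
  have h1 := ((hasDerivAt_pow 2 r).add_const (1 : ℝ)).rpow_const (p := -(m : ℝ) / 2)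
    (Or.inl h0.ne')
  refine ((hasDerivAt_pow m r).mul h1).congr_deriv ?_
  obtain ⟨k, rfl⟩ : ∃ k, m = k + 1 := ⟨m - 1, by omega⟩
  have h2 : (r ^ 2 + 1) ^ (-((k + 1 : ℕ) : ℝ) / 2) =
      (r ^ 2 + 1) * (r ^ 2 + 1) ^ (-((k + 1 : ℕ) : ℝ) / 2 - 1) := by
    rw [Real.rpow_sub_one h0.ne']; field_simp
  rw [h2]
  push_cast
  ring

lemma tendsto_radial_primitive (m : ℕ) :
    Tendsto (fun r : ℝ => r ^ m * (r ^ 2 + 1) ^ (-(m : ℝ) / 2)) atTop (𝓝 1) := by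
  have h1 : Tendsto (fun r : ℝ => (1 + (r ^ 2)⁻¹) ^ (-(m : ℝ) / 2)) atTop (𝓝 1) := by
    have h2 : Tendsto (fun r : ℝ => 1 + (r ^ 2)⁻¹) atTop (𝓝 1) := by
      simpa using ((tendsto_pow_atTop two_ne_zero).inv_tendsto_atTop).const_add (1 : ℝ)
    simpa using h2.rpow_const (p := -(m : ℝ) / 2) (Or.inl one_ne_zero)
  refine h1.congr' ((eventually_gt_atTop 0).mono fun r hr => ?_)
  beta_reduce
  have h3 : r ^ 2 + 1 = r ^ 2 * (1 + (r ^ 2)⁻¹) := by field_simp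
  rw [h3, Real.mul_rpow (by positivity) (by positivity), ← mul_assoc]
  have h4 : (r ^ 2) ^ (-(m : ℝ) / 2) = (r ^ m)⁻¹ := by
    rw [← Real.rpow_natCast r 2, ← Real.rpow_mul hr.le, ← Real.rpow_natCast r m,
      ← Real.rpow_neg hr.le]
    congr 1
    push_cast
    ring
  rw [h4, mul_inv_cancel₀ (by positivity), one_mul]

lemma integral_radial {m : ℕ} (hm : 1 ≤ m) :
    ∫ r in Ioi (0 : ℝ), r ^ (m - 1) * (m * (r ^ 2 + 1) ^ (-(m : ℝ) / 2 - 1)) = 1 := by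
  rw [integral_Ioi_of_hasDerivAt_of_nonneg' (fun r _ => hasDerivAt_radial_primitive hm r)
    (fun r (hr : 0 < r) => by positivity) (tendsto_radial_primitive m)]
  simp [show m ≠ 0 by omega]

variable {E : Type*} [NormedAddCommGroup E] [InnerProductSpace ℝ E] [FiniteDimensional ℝ E]
  [MeasurableSpace E] [BorelSpace E]

lemma integral_mollifier {m : ℕ} (hm : 1 ≤ m) (hE : finrank ℝ E = m) :
    ∫ z : E, m * (‖z‖ ^ 2 + 1) ^ (-(m : ℝ) / 2 - 1) =
      m * (volume : Measure E).real (ball 0 1) := by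
  have : Nontrivial E := Module.nontrivial_of_finrank_pos (R := ℝ) (by omega)
  rw [integral_fun_norm_addHaar volume (fun r : ℝ => m * (r ^ 2 + 1) ^ (-(m : ℝ) / 2 - 1)), hE]
  simp_rw [smul_eq_mul]
  rw [integral_radial hm]
  simp

lemma tendsto_integral_mollifier {m : ℕ} (hm : 1 ≤ m) (hE : finrank ℝ E = m) {h : E → ℝ} {e : E}
    (hi : Integrable h) (hc : ContinuousAt h e) :
    Tendsto (fun c : ℝ => ∫ y, h y *
      (m * (c⁻¹) ^ 2 * (‖y - e‖ ^ 2 + (c⁻¹) ^ 2) ^ (-(m : ℝ) / 2 - 1))) atTop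
      (𝓝 (m * (volume : Measure E).real (ball 0 1) * h e)) := by
  have : Nontrivial E := Module.nontrivial_of_finrank_pos (R := ℝ) (by omega)
  set ω : ℝ := m * (volume : Measure E).real (ball 0 1) with hω
  have hω0 : 0 < ω := by
    have : 0 < (volume : Measure E).real (ball 0 1) :=
      ENNReal.toReal_pos (measure_ball_pos _ _ one_pos).ne' measure_ball_lt_top.ne
    positivity
  have key := tendsto_integral_comp_smul_smul_of_integrable' (μ := (volume : Measure E))
    (φ := fun z => ω⁻¹ * (m * (‖z‖ ^ 2 + 1) ^ (-(m : ℝ) / 2 - 1)))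
    (fun z => by positivity)
    (by rw [integral_const_mul, integral_mollifier hm hE, inv_mul_cancel₀ hω0.ne'])
    (by
      rw [hE]
      have h1 : Tendsto (fun z : E => ω⁻¹ * m * (‖z‖ ^ 2 + 1)⁻¹) (Bornology.cobounded E) (𝓝 0) := by
        have h2 : Tendsto (fun z : E => ‖z‖ ^ 2 + 1) (Bornology.cobounded E) atTop :=
          tendsto_atTop_add_const_right _ _
            ((tendsto_pow_atTop two_ne_zero).comp tendsto_norm_cobounded_atTop)
        simpa using h2.inv_tendsto_atTop.const_mul (ω⁻¹ * m)
      refine squeeze_zero (fun z => by positivity) (fun z => ?_) h1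
      have h3 := bracket_rpow_mul_norm_le one_pos (-1) m z
      rw [Real.rpow_neg_one, one_pow, show -1 - (m : ℝ) / 2 = -(m : ℝ) / 2 - 1 by ring] at h3
      calc _ = ω⁻¹ * m * ((‖z‖ ^ 2 + 1) ^ (-(m : ℝ) / 2 - 1) * ‖z‖ ^ m) := by ring
        _ ≤ _ := by gcongr) hi hc
  rw [hE] at key
  refine (key.const_mul ω).congr' ((eventually_gt_atTop 0).mono fun c hc => ?_)
  rw [← integral_const_mul]
  congr 1 with y
  have h1 : ‖c • (e - y)‖ ^ 2 + 1 = c ^ 2 * (‖y - e‖ ^ 2 + (c⁻¹) ^ 2) := by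
    rw [norm_smul, norm_sub_rev, mul_pow, Real.norm_of_nonneg hc.le]
    field_simp
  have h2 : (c ^ 2) ^ (-(m : ℝ) / 2 - 1) = (c ^ m)⁻¹ * (c⁻¹) ^ 2 := by
    rw [Real.rpow_sub_one (by positivity), ← Real.rpow_natCast c 2, ← Real.rpow_mul hc.le,
      ← Real.rpow_natCast c m, ← Real.rpow_neg hc.le]
    rw [inv_pow, div_eq_mul_inv, Real.rpow_natCast c 2]
    congr 2
    push_cast
    ring
  rw [h1, Real.mul_rpow (by positivity) (by positivity), h2, smul_eq_mul]
  field_simp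

variable {v : E → ℝ} {C : ℝ} {e : E}

lemma HomBounds.tendsto_integral_second {ι : Type*} [Fintype ι] (β : OrthonormalBasis ι ℝ E)
    (hv : HomBounds v C) (hm : 2 ≤ Fintype.card ι) (he : ‖e‖ = 1) (ξ : E) :
    Tendsto (fun c : ℝ => ∫ y, fderiv ℝ (fderiv ℝ v) y ξ ξ * (Fintype.card ι * (c⁻¹) ^ 2 *
        (‖y - e‖ ^ 2 + (c⁻¹) ^ 2) ^ (-(Fintype.card ι : ℝ) / 2 - 1))) atTop
      (𝓝 (Fintype.card ι * (volume : Measure E).real (ball 0 1) *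
        fderiv ℝ (fderiv ℝ v) e ξ ξ)) := by
  have hE : finrank ℝ E = Fintype.card ι := finrank_eq_card_basis β.toBasis
  set m := Fintype.card ι
  have : Nontrivial E := Module.nontrivial_of_finrank_pos (R := ℝ) (by omega)
  have hC := hv.nonneg
  have hae : ∀ᵐ y : E, y ≠ 0 := by simp [ae_iff]
  have he0 : e ≠ 0 := by rintro rfl; simp at he
  set h : E → ℝ := fun y => fderiv ℝ (fderiv ℝ v) y ξ ξ with hh
  set ρ : ℝ → E → ℝ := fun ε y => m * ε ^ 2 * (‖y - e‖ ^ 2 + ε ^ 2) ^ (-(m : ℝ) / 2 - 1) with hρ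
  have hint : ∀ ε > 0, Integrable fun y => h y * ρ ε y := fun ε hε => by
    simp_rw [hρ, m, ← sum_kernelHess_self β hε, Finset.mul_sum]
    exact integrable_finsetSum _ fun i _ => hv.integrable_second_mul hm hE hε he _ _ _ _
  have hhm : Measurable h := measurable_fderiv_fderiv_apply v ξ ξ
  have hnear : Tendsto (fun c : ℝ => ∫ y in ball e (1 / 2), h y * ρ c⁻¹ y) atTop
      (𝓝 (m * (volume : Measure E).real (ball 0 1) * h e)) := by
    have hi : Integrable ((ball e (1 / 2)).indicator h) := by
      rw [integrable_indicator_iff measurableSet_ball]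
      refine Measure.integrableOn_of_bounded (M := C * 2 * ‖ξ‖ * ‖ξ‖) measure_ball_lt_top.ne
        hhm.aestronglyMeasurable
        ((ae_restrict_mem measurableSet_ball).mono fun y hy => ?_)
      rw [mem_ball, dist_eq_norm] at hy
      have h1 : 1 / 2 ≤ ‖y‖ := by
        have := norm_sub_norm_le e y
        rw [he, norm_sub_rev] at this
        linarith
      have hy0 : y ≠ 0 := by
        rintro rfl
        norm_num at h1
      refine (hv.abs_fderiv_fderiv_le hy0 ξ ξ).trans ?_
      have : ‖y‖⁻¹ ≤ 2 := by
        rw [inv_le_comm₀ (by positivity) two_pos]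
        linarith
      gcongr
    have heq : (ball e (1 / 2)).indicator h =ᶠ[𝓝 e] h :=
      eventuallyEq_of_mem (ball_mem_nhds e (by norm_num)) (eqOn_indicator)
    have hci : ContinuousAt ((ball e (1 / 2)).indicator h) e :=
      (continuousAt_congr heq).2 (hv.continuousAt_second he0 ξ ξ)
    have key := tendsto_integral_mollifier (by omega) hE hi hci
    rw [heq.eq_of_nhds] at key
    refine key.congr fun c => ?_
    rw [← integral_indicator measurableSet_ball]
    congr 1 with y
    exact (indicator_mul_left _ h (ρ c⁻¹)).symm
  set K : ℝ := C * ‖ξ‖ * ‖ξ‖ * (m * ((2⁻¹ : ℝ) ^ (-(m : ℝ) / 2 - 1) *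
    ((2 + 3 / (1 / 2 : ℝ) ^ 2)⁻¹) ^ (-(m : ℝ) / 2 - 1))) with hK
  have hm0 : (0 : ℝ) ≤ m := by positivity
  have hfar : Tendsto (fun c : ℝ => ∫ y in (ball e (1 / 2))ᶜ, h y * ρ c⁻¹ y) atTop (𝓝 0) := by
    have hlim : Tendsto (fun c : ℝ => (c⁻¹) ^ 2 * ∫ y in (ball e (1 / 2))ᶜ, K * weight m y) atTop
        (𝓝 0) := by
      simpa using (tendsto_inv_atTop_zero.pow 2).mul_const
        (∫ y in (ball e (1 / 2))ᶜ, K * weight m y)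
    refine squeeze_zero_norm' ((eventually_gt_atTop 0).mono fun c hc => ?_) hlim
    rw [← integral_const_mul]
    refine norm_integral_le_of_norm_le
      ((((integrable_weight hm hE volume).const_mul K).const_mul _).integrableOn) ?_
    rw [ae_restrict_iff' measurableSet_ball.compl]
    refine hae.mono fun y hy hyb => ?_
    rw [mem_compl_iff, mem_ball, dist_eq_norm, not_lt] at hyb
    have h1 : 2⁻¹ * (‖y - e‖ ^ 2 + (1 / 2) ^ 2) ≤ ‖y - e‖ ^ 2 + (c⁻¹) ^ 2 := by
      nlinarith [sq_nonneg c⁻¹]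
    have hr : -(m : ℝ) / 2 - 1 ≤ 0 := by linarith
    have h2 : (‖y - e‖ ^ 2 + (c⁻¹) ^ 2) ^ (-(m : ℝ) / 2 - 1) ≤ (2⁻¹ : ℝ) ^ (-(m : ℝ) / 2 - 1) *
        (((2 + 3 / (1 / 2 : ℝ) ^ 2)⁻¹) ^ (-(m : ℝ) / 2 - 1) * (1 + ‖y‖ ^ 2) ^ (-(m : ℝ) / 2)) := by
      refine (Real.rpow_le_rpow_of_nonpos (by positivity) h1 hr).trans ?_
      rw [Real.mul_rpow (by positivity) (by positivity)]
      gcongr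
      refine (bracket_rpow_neg_le he (by norm_num) hr y).trans ?_
      gcongr
      · nlinarith [sq_nonneg ‖y‖]
      · linarith
    rw [norm_mul]
    calc _ ≤ (C * ‖y‖⁻¹ * ‖ξ‖ * ‖ξ‖) * (m * (c⁻¹) ^ 2 * ((2⁻¹ : ℝ) ^ (-(m : ℝ) / 2 - 1) *
        (((2 + 3 / (1 / 2 : ℝ) ^ 2)⁻¹) ^ (-(m : ℝ) / 2 - 1) *
          (1 + ‖y‖ ^ 2) ^ (-(m : ℝ) / 2)))) := by
          refine mul_le_mul (hv.abs_fderiv_fderiv_le hy ξ ξ) ?_ (abs_nonneg _) (by positivity)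
          rw [Real.norm_of_nonneg (by positivity)]
          exact mul_le_mul_of_nonneg_left h2 (by positivity)
      _ = _ := by rw [weight, hK]; ring
  have hsum := hnear.add hfar
  rw [add_zero] at hsum
  refine hsum.congr' ((eventually_gt_atTop 0).mono fun c hc => ?_)
  exact integral_add_compl measurableSet_ball (hint c⁻¹ (by positivity))

end Mollifier

section Homogeneous

variable {E : Type*} [NormedAddCommGroup E] [NormedSpace ℝ E] {v : E → ℝ}

lemma fderiv_smul_of_homogeneous
    (hv : ∀ t : ℝ, 0 < t → ∀ y : E, y ≠ 0 → v (t • y) = t * v y) {t : ℝ} (ht : 0 < t) {y : E}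
    (hy : y ≠ 0) : fderiv ℝ v (t • y) = fderiv ℝ v y := by
  have h : (fun x => v (t • x)) =ᶠ[𝓝 y] fun x => t • v x :=
    eventually_of_mem (isOpen_compl_singleton.mem_nhds hy) fun x hx => hv t ht x hx
  have h1 := h.fderiv_eq (𝕜 := ℝ)
  rw [fderiv_comp_smul, show (fun x => t • v x) = t • v from rfl, fderiv_const_smul_field] at h1
  exact smul_right_injective _ ht.ne' h1

lemma fderiv_fderiv_smul_of_homogeneous
    (hv : ∀ t : ℝ, 0 < t → ∀ y : E, y ≠ 0 → v (t • y) = t * v y) {t : ℝ} (ht : 0 < t) {y : E}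
    (hy : y ≠ 0) : fderiv ℝ (fderiv ℝ v) (t • y) = t⁻¹ • fderiv ℝ (fderiv ℝ v) y := by
  have h : (fun x => fderiv ℝ v (t • x)) =ᶠ[𝓝 y] fun x => fderiv ℝ v x :=
    eventually_of_mem (isOpen_compl_singleton.mem_nhds hy) fun x hx =>
      fderiv_smul_of_homogeneous hv ht hx
  have h1 := h.fderiv_eq (𝕜 := ℝ)
  rw [fderiv_comp_smul] at h1
  rw [← h1, smul_smul, inv_mul_cancel₀ ht.ne', one_smul]

lemma exists_homBounds [FiniteDimensional ℝ E]
    (hv : ∀ t : ℝ, 0 < t → ∀ y : E, y ≠ 0 → v (t • y) = t * v y)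
    (hC2 : ContDiffOn ℝ 2 v {0}ᶜ) : ∃ C, HomBounds v C := by
  have hat : ∀ y ≠ 0, ContDiffAt ℝ 2 v y := fun y hy =>
    hC2.contDiffAt (isOpen_compl_singleton.mem_nhds hy)
  have hs : ∀ y ∈ sphere (0 : E) 1, y ≠ 0 := fun y hy => ne_zero_of_mem_unit_sphere ⟨y, hy⟩
  have h1 : ContinuousOn (fderiv ℝ v) (sphere 0 1) := fun y hy =>
    ((hat y (hs y hy)).fderiv_right (m := 1) (by norm_num)).continuousAt.continuousWithinAt
  have h2 : ContinuousOn (fun y => ‖fderiv ℝ (fderiv ℝ v) y‖) (sphere 0 1) := fun y hy =>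
    (((hat y (hs y hy)).fderiv_right (m := 1) (by norm_num)).fderiv_right (m := 0)
      (by norm_num)).continuousAt.norm.continuousWithinAt
  obtain ⟨C1, hC1⟩ := (isCompact_sphere (0 : E) 1).exists_bound_of_continuousOn h1
  obtain ⟨C2, hC2'⟩ := (isCompact_sphere (0 : E) 1).exists_bound_of_continuousOn h2
  have hn : ∀ y : E, y ≠ 0 → ‖y‖⁻¹ • y ∈ sphere (0 : E) 1 := fun y hy => by
    simp [norm_smul, hy]
  have hyn : ∀ y : E, y ≠ 0 → ‖y‖ • (‖y‖⁻¹ • y) = y := fun y hy => by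
    rw [smul_smul, mul_inv_cancel₀ (norm_ne_zero_iff.2 hy), one_smul]
  refine ⟨max C1 C2, hC2, fun y hy => ?_, fun y hy => ?_⟩
  · rw [← hyn y hy, fderiv_smul_of_homogeneous hv (norm_pos_iff.2 hy) (hs _ (hn y hy))]
    exact (hC1 _ (hn y hy)).trans (le_max_left _ _)
  · have h := fderiv_fderiv_smul_of_homogeneous hv (norm_pos_iff.2 hy) (hs _ (hn y hy))
    rw [hyn y hy] at h
    refine h ▸ (ContinuousLinearMap.opNorm_smul_le _ _).trans ?_
    rw [norm_inv, norm_norm, mul_comm]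
    gcongr
    exact (le_abs_self _).trans <| (hC2' _ (hn y hy)).trans (le_max_right _ _)

/-- Euler's identity for the Hessian of a function homogeneous of degree `1`. -/
lemma HomBounds.fderiv_fderiv_self {C : ℝ} (hb : HomBounds v C)
    (hv : ∀ t : ℝ, 0 < t → ∀ y : E, y ≠ 0 → v (t • y) = t * v y) {y : E} (hy : y ≠ 0) :
    fderiv ℝ (fderiv ℝ v) y y = 0 := by
  have h1 : HasDerivAt (fun t : ℝ => t • y) y 1 := by
    simpa using (hasDerivAt_id (1 : ℝ)).smul_const y
  have h2 : HasFDerivAt (fderiv ℝ v) (fderiv ℝ (fderiv ℝ v) y) ((1 : ℝ) • y) := by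
    rw [one_smul]; exact hb.hasFDerivAt_fderiv hy
  have h3 := h2.comp_hasDerivAt (1 : ℝ) h1
  have h4 : (fderiv ℝ v ∘ fun t : ℝ => t • y) =ᶠ[𝓝 1] fun _ => fderiv ℝ v y :=
    (eventually_gt_nhds one_pos).mono fun t ht => fderiv_smul_of_homogeneous hv ht hy
  exact (h3.congr_of_eventuallyEq h4.symm).unique (hasDerivAt_const _ _)

end Homogeneous

section SubNorm

variable {E : Type*} [NormedAddCommGroup E] [InnerProductSpace ℝ E] {u : E → ℝ}

lemma hasFDerivAt_norm_real {y : E} (hy : y ≠ 0) :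
    HasFDerivAt (fun y : E => ‖y‖) (‖y‖⁻¹ • innerSL ℝ y) y := by
  have hn : ‖y‖ ≠ 0 := norm_ne_zero_iff.2 hy
  have h := (hasFDerivAt_norm_sq_real y).sqrt (by positivity)
  simp_rw [Real.sqrt_sq (norm_nonneg _)] at h
  refine h.congr_fderiv ?_
  ext a
  simp
  field_simp

lemma fderiv_fderiv_sub_norm (hC2 : ContDiffOn ℝ 2 u {0}ᶜ) (k : ℝ) {y : E} (hy : y ≠ 0) (a b : E) :
    fderiv ℝ (fderiv ℝ fun x => u x - k * ‖x‖) y a b =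
      fderiv ℝ (fderiv ℝ u) y a b - k * (‖y‖⁻¹ * ⟪a, b⟫ - (‖y‖ ^ 3)⁻¹ * (⟪y, a⟫ * ⟪y, b⟫)) := by
  have hn : ‖y‖ ≠ 0 := norm_ne_zero_iff.2 hy
  have hat : ∀ x ≠ 0, ContDiffAt ℝ 2 u x := fun x hx =>
    hC2.contDiffAt (isOpen_compl_singleton.mem_nhds hx)
  have h1 : (fderiv ℝ fun x => u x - k * ‖x‖) =ᶠ[𝓝 y]
      fun x => fderiv ℝ u x - k • ‖x‖⁻¹ • innerSL ℝ x :=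
    eventually_of_mem (isOpen_compl_singleton.mem_nhds hy) fun x hx =>
      ((((hat x hx).differentiableAt two_ne_zero).hasFDerivAt).sub
        ((hasFDerivAt_norm_real hx).const_mul k)).fderiv
  rw [h1.fderiv_eq]
  have h2 : HasFDerivAt (fderiv ℝ u) (fderiv ℝ (fderiv ℝ u) y) y :=
    (((hat y hy).fderiv_right (m := 1) (by norm_num)).differentiableAt one_ne_zero).hasFDerivAt
  have h3 : HasFDerivAt (fun x : E => ‖x‖⁻¹) (-(‖y‖ ^ 2)⁻¹ • ‖y‖⁻¹ • innerSL ℝ y) y :=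
    (hasDerivAt_inv hn).comp_hasFDerivAt y (hasFDerivAt_norm_real hy)
  have h4 : HasFDerivAt (fun x : E => innerSL ℝ x) (innerSL ℝ) y := (innerSL ℝ).hasFDerivAt
  have h5 : HasFDerivAt (fun x => fderiv ℝ u x - k • ‖x‖⁻¹ • innerSL ℝ x) _ y :=
    h2.sub ((h3.smul h4).const_smul k)
  have h6 : innerSL ℝ a b = ⟪a, b⟫ := innerSL_apply_apply ℝ a b
  rw [h5.fderiv]
  simp [h6]
  field_simp
  ring

end SubNorm

section Estimate

variable {E : Type*} [NormedAddCommGroup E] [InnerProductSpace ℝ E] [FiniteDimensional ℝ E]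
  [MeasurableSpace E] [BorelSpace E] {v : E → ℝ} {C : ℝ} {e : E}

/-- The singular integral estimate for the Hessian in terms of the Laplacian. -/
lemma HomBounds.abs_second_le {ι : Type*} [Fintype ι] (β : OrthonormalBasis ι ℝ E)
    (hv : HomBounds v C) {n : ℕ} (hn : 1 ≤ n) (hcard : Fintype.card ι = n + 1) (he : ‖e‖ = 1)
    {J : E → ℝ} (hJ : Integrable J)
    (hle : ∀ᵐ y, |∑ i, fderiv ℝ (fderiv ℝ v) y (β i) (β i)| * (‖y - e‖ ^ (n + 1))⁻¹ ≤ J y)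
    {ξ : E} (hξ : ‖ξ‖ = 1) :
    (n + 1) * (volume : Measure E).real (ball 0 1) * |fderiv ℝ (fderiv ℝ v) e ξ ξ| ≤
      n * ∫ y, J y := by
  have hE : finrank ℝ E = Fintype.card ι := finrank_eq_card_basis β.toBasis
  have : Nontrivial E := Module.nontrivial_of_finrank_pos (R := ℝ) (by omega)
  have hae : ∀ᵐ y : E, y ≠ e := by simp [ae_iff]
  have hlim := (hv.tendsto_integral_second β (by omega) he ξ).abs
  rw [hcard, abs_mul, abs_of_nonneg (by positivity), Nat.cast_add_one] at hlim
  refine le_of_tendsto hlim ((eventually_gt_atTop 0).mono fun c hc => ?_)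
  have h := hv.integral_second_mul_eq β (by omega) (inv_pos.2 hc) he ξ
  rw [hcard, Nat.cast_add_one] at h
  rw [h, ← integral_const_mul, ← Real.norm_eq_abs]
  refine norm_integral_le_of_norm_le (hJ.const_mul _) ?_
  filter_upwards [hae, hle] with y hy hyJ
  rw [norm_mul, Real.norm_eq_abs, Real.norm_eq_abs]
  calc _ ≤ |∑ i, fderiv ℝ (fderiv ℝ v) y (β i) (β i)| * (n * (‖y - e‖ ^ (n + 1))⁻¹) := by
        gcongr
        exact abs_kernelHess_self_le (inv_pos.2 hc) hn (sub_ne_zero.2 hy) hξ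
    _ = n * (|∑ i, fderiv ℝ (fderiv ℝ v) y (β i) (β i)| * (‖y - e‖ ^ (n + 1))⁻¹) := by ring
    _ ≤ _ := by gcongr

end Estimate

section Convexity

variable {E : Type*} [NormedAddCommGroup E] [NormedSpace ℝ E] {u : E → ℝ}

lemma convexOn_line_of_second_nonneg (hC2 : ContDiffOn ℝ 2 u {0}ᶜ)
    (hpos : ∀ y ≠ 0, ∀ d, 0 ≤ fderiv ℝ (fderiv ℝ u) y d d) {x d : E}
    (hline : ∀ s : ℝ, x + s • d ≠ 0) : ConvexOn ℝ univ fun s : ℝ => u (x + s • d) := by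
  have hat : ∀ y ≠ 0, ContDiffAt ℝ 2 u y := fun y hy =>
    hC2.contDiffAt (isOpen_compl_singleton.mem_nhds hy)
  have hl : ∀ s : ℝ, HasDerivAt (fun s : ℝ => x + s • d) d s := fun s => by
    simpa using ((hasDerivAt_id s).smul_const d).const_add x
  have h1 : ∀ s : ℝ, HasDerivAt (fun s : ℝ => u (x + s • d)) (fderiv ℝ u (x + s • d) d) s :=
    fun s => ((hat _ (hline s)).differentiableAt two_ne_zero).hasFDerivAt.comp_hasDerivAt s (hl s)
  have h2 : ∀ s : ℝ, HasDerivAt (fun s : ℝ => fderiv ℝ u (x + s • d) d)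
      (fderiv ℝ (fderiv ℝ u) (x + s • d) d d) s := fun s => by
    have h := ((((hat _ (hline s)).fderiv_right (m := 1) (by norm_num)).differentiableAt
      one_ne_zero).hasFDerivAt).comp_hasDerivAt s (hl s)
    simpa using h.clm_apply (hasDerivAt_const s d)
  have hd : deriv (fun s : ℝ => u (x + s • d)) = fun s => fderiv ℝ u (x + s • d) d :=
    funext fun s => (h1 s).deriv
  refine convexOn_univ_of_deriv2_nonneg (fun s => (h1 s).differentiableAt) ?_ fun s => ?_
  · rw [hd]
    exact fun s => (h2 s).differentiableAt
  · rw [Function.iterate_succ, Function.iterate_one, Function.comp_apply, hd, (h2 s).deriv]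
    exact hpos _ (hline s) d

/-- In dimension at least three, a continuous function with nonnegative Hessian away from the origin
is convex. -/
lemma convexOn_univ_of_second_nonneg (hdim : 2 < finrank ℝ E) (hu : Continuous u)
    (hC2 : ContDiffOn ℝ 2 u {0}ᶜ) (hpos : ∀ y ≠ 0, ∀ d, 0 ≤ fderiv ℝ (fderiv ℝ u) y d d) :
    ConvexOn ℝ univ u := by
  refine ⟨convex_univ, fun x _ y _ a b ha hb hab => ?_⟩
  obtain ⟨w, hw⟩ : ∃ w, w ∉ Submodule.span ℝ {x, y} := by
    by_contra! h
    have htop : Submodule.span ℝ {x, y} = ⊤ := eq_top_iff.2 fun w _ => h w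
    classical
    have hle : finrank ℝ (Submodule.span ℝ (({x, y} : Finset E) : Set E)) ≤ _ :=
      finrank_span_finset_le_card _
    rw [Finset.coe_pair, htop, finrank_top] at hle
    exact absurd (hle.trans Finset.card_le_two) (by omega)
  have hx : x ∈ Submodule.span ℝ {x, y} := Submodule.subset_span (by simp)
  have hy : y ∈ Submodule.span ℝ {x, y} := Submodule.subset_span (by simp)
  have key : ∀ t ∈ ({0}ᶜ : Set ℝ),
      u (a • x + b • y + t • w) ≤ a * u (x + t • w) + b * u (y + t • w) := by
    intro t ht
    have hline : ∀ s : ℝ, (x + t • w) + s • (y - x) ≠ 0 := by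
      intro s h0
      apply hw
      have h1 : t • w = -(x + s • (y - x)) := by
        rw [eq_neg_iff_add_eq_zero, ← h0]
        abel
      have h2 : t • w ∈ Submodule.span ℝ {x, y} := by
        rw [h1]
        exact Submodule.neg_mem _ (Submodule.add_mem _ hx (Submodule.smul_mem _ _
          (Submodule.sub_mem _ hy hx)))
      exact (Submodule.smul_mem_iff _ ht).1 h2
    have h := (convexOn_line_of_second_nonneg hC2 hpos hline).2 (mem_univ 0) (mem_univ 1) ha hb hab
    simp only [smul_eq_mul, mul_zero, mul_one, zero_add, zero_smul, one_smul, add_zero] at h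
    have e1 : x + t • w + b • (y - x) = a • x + b • y + t • w := by
      rw [show a = 1 - b by linarith]
      module
    have e2 : x + t • w + (y - x) = y + t • w := by abel
    rwa [e1, e2] at h
  have h1 : Tendsto (fun t : ℝ => u (a • x + b • y + t • w)) (𝓝[≠] 0) (𝓝 (u (a • x + b • y))) := by
    have : Continuous fun t : ℝ => u (a • x + b • y + t • w) := by fun_prop
    simpa using (this.tendsto 0).mono_left nhdsWithin_le_nhds
  have h2 : Tendsto (fun t : ℝ => a * u (x + t • w) + b * u (y + t • w)) (𝓝[≠] 0)
      (𝓝 (a * u x + b * u y)) := by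
    have : Continuous fun t : ℝ => a * u (x + t • w) + b * u (y + t • w) := by fun_prop
    simpa using (this.tendsto 0).mono_left nhdsWithin_le_nhds
  exact le_of_tendsto_of_tendsto h1 h2 (eventually_mem_nhdsWithin.mono key)

end Convexity

section GammaKernel

variable {E : Type*} [NormedAddCommGroup E] [InnerProductSpace ℝ E] {e e₀ y : E}

/-- The integrand in the definition of `gammaConst`, with pole at `e`. -/
noncomputable def gammaKernel (n : ℕ) (α : ℝ) (e y : E) : ℝ :=
  (‖y - e‖ ^ (n + 1))⁻¹ * ‖y‖⁻¹ * Real.arccos ⟪‖y‖⁻¹ • y, e⟫ ^ α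

lemma gammaKernel_map (n : ℕ) (α : ℝ) (R : E ≃ₗᵢ[ℝ] E) (e y : E) :
    gammaKernel n α (R e) (R y) = gammaKernel n α e y := by
  simp only [gammaKernel, ← map_sub, LinearIsometryEquiv.norm_map, ← map_smul,
    LinearIsometryEquiv.inner_map_map]

lemma exists_linearIsometryEquiv_apply_eq (h : ‖e₀‖ = ‖e‖) : ∃ R : E ≃ₗᵢ[ℝ] E, R e₀ = e :=
  ⟨_, Submodule.reflection_sub h⟩

variable [FiniteDimensional ℝ E] [MeasurableSpace E] [BorelSpace E]

lemma integral_gammaKernel (n : ℕ) (α : ℝ) (h : ‖e₀‖ = ‖e‖) :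
    ∫ y, gammaKernel n α e y = ∫ y, gammaKernel n α e₀ y := by
  obtain ⟨R, hR⟩ := exists_linearIsometryEquiv_apply_eq h.symm
  rw [← R.measurePreserving.integral_comp R.toMeasurableEquiv.measurableEmbedding
    (gammaKernel n α e₀)]
  refine integral_congr_ae (ae_of_all _ fun y => ?_)
  simp only [← hR, gammaKernel_map]

end GammaKernel

section Decomposition

variable {E : Type*} [NormedAddCommGroup E] [InnerProductSpace ℝ E] [FiniteDimensional ℝ E]
  {u : E → ℝ}

/-- For a function homogeneous of degree `1`, the Hessian is nonnegative as soon as it is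
nonnegative at points of the unit sphere along unit tangent vectors. -/
lemma second_nonneg_of_tangent (hC2 : ContDiffOn ℝ 2 u {0}ᶜ)
    (hu : ∀ t : ℝ, 0 < t → ∀ y : E, y ≠ 0 → u (t • y) = t * u y)
    (h : ∀ e ξ : E, ‖e‖ = 1 → ‖ξ‖ = 1 → ⟪e, ξ⟫ = 0 → 0 ≤ fderiv ℝ (fderiv ℝ u) e ξ ξ)
    {y : E} (hy : y ≠ 0) (d : E) : 0 ≤ fderiv ℝ (fderiv ℝ u) y d d := by
  obtain ⟨C, hb⟩ := exists_homBounds hu hC2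
  have hn : 0 < ‖y‖ := norm_pos_iff.2 hy
  obtain ⟨e, he⟩ : ∃ e, ‖y‖⁻¹ • y = e := ⟨_, rfl⟩
  have he1 : ‖e‖ = 1 := by rw [← he, norm_smul, norm_inv, norm_norm, inv_mul_cancel₀ hn.ne']
  have he0 : e ≠ 0 := norm_ne_zero_iff.1 (by rw [he1]; exact one_ne_zero)
  have hye : y = ‖y‖ • e := by rw [← he, smul_smul, mul_inv_cancel₀ hn.ne', one_smul]
  have hscale : fderiv ℝ (fderiv ℝ u) y = ‖y‖⁻¹ • fderiv ℝ (fderiv ℝ u) e := by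
    conv_lhs => rw [hye]
    exact fderiv_fderiv_smul_of_homogeneous hu hn he0
  obtain ⟨η, hη⟩ : ∃ η, d - ⟪e, d⟫ • e = η := ⟨_, rfl⟩
  have hd : d = ⟪e, d⟫ • e + η := by rw [← hη]; abel
  have horth : ⟪e, η⟫ = 0 := by
    rw [← hη, inner_sub_right, inner_smul_right, real_inner_self_eq_norm_sq, he1]
    ring
  have hself := hb.fderiv_fderiv_self hu he0
  have hη' : fderiv ℝ (fderiv ℝ u) e d d = fderiv ℝ (fderiv ℝ u) e η η := by
    have h1 : fderiv ℝ (fderiv ℝ u) e η e = 0 := by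
      rw [hb.symm he0 η e, hself]
      rfl
    rw [hd]
    simp [hself, h1]
  have key : 0 ≤ fderiv ℝ (fderiv ℝ u) e η η := by
    rcases eq_or_ne η 0 with rfl | h0
    · simp
    have hη0 : ‖η‖ ≠ 0 := norm_ne_zero_iff.2 h0
    have h1 := h e (‖η‖⁻¹ • η) he1 (by simp [norm_smul, hη0]) (by simp [inner_smul_right, horth])
    simp only [map_smul, smul_apply, smul_eq_mul, ← mul_assoc] at h1
    exact nonneg_of_mul_nonneg_right h1 (by positivity)
  rw [hscale, smul_apply, smul_apply, hη']
  exact mul_nonneg (by positivity) key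

end Decomposition

lemma laplacian_eq_sum {m : ℕ} {u : EuclideanSpace ℝ (Fin m) → ℝ} (hC2 : ContDiffOn ℝ 2 u {0}ᶜ)
    {x : EuclideanSpace ℝ (Fin m)} (hx : x ≠ 0) :
    laplacian u x = ∑ i, fderiv ℝ (fderiv ℝ u) x (EuclideanSpace.basisFun (Fin m) ℝ i)
      (EuclideanSpace.basisFun (Fin m) ℝ i) := by
  have hd : DifferentiableAt ℝ (fderiv ℝ u) x :=
    ((hC2.contDiffAt (isOpen_compl_singleton.mem_nhds hx)).fderiv_right (m := 1)
      (by norm_num)).differentiableAt one_ne_zero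
  refine Finset.sum_congr rfl fun i _ => ?_
  rw [EuclideanSpace.basisFun_apply]
  have h := hd.hasFDerivAt.clm_apply (hasFDerivAt_const (EuclideanSpace.single i (1 : ℝ)) x)
  rw [h.fderiv]
  simp

lemma omega_n_eq (n : ℕ) :
    omega_n n = (n + 1) * (volume : Measure (EuclideanSpace ℝ (Fin (n + 1)))).real (ball 0 1) := by
  have h := Measure.toSphere_real_apply_univ (volume : Measure (EuclideanSpace ℝ (Fin (n + 1))))
  rw [finrank_euclideanSpace_fin, Nat.cast_add_one] at h
  exact h

/-- The Hessian of `u` is nonnegative at points of the unit sphere along unit tangent vectors. -/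
lemma tangent_second_nonneg (n : ℕ) (hn : 2 ≤ n) (α : ℝ)
    (f u : EuclideanSpace ℝ (Fin (n + 1)) → ℝ)
    (hf_pos : ∀ x ∈ sphere (0 : EuclideanSpace ℝ (Fin (n + 1))) 1, 0 < f x)
    (hf_hom : ∀ t : ℝ, 0 < t → ∀ y : EuclideanSpace ℝ (Fin (n + 1)), y ≠ 0 →
      f (t • y) = t⁻¹ * f y)
    (hf_seminorm : ∀ x ∈ sphere (0 : EuclideanSpace ℝ (Fin (n + 1))) 1,
      ∀ z ∈ sphere (0 : EuclideanSpace ℝ (Fin (n + 1))) 1,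
        |f x - f z| ≤ gammaConst n α *
          sInf (f '' sphere (0 : EuclideanSpace ℝ (Fin (n + 1))) 1) *
          Real.arccos ⟪x, z⟫ ^ α)
    (hu_hom : ∀ t : ℝ, 0 < t → ∀ y : EuclideanSpace ℝ (Fin (n + 1)), y ≠ 0 →
      u (t • y) = t * u y)
    (hu_C2 : ContDiffOn ℝ 2 u {(0 : EuclideanSpace ℝ (Fin (n + 1)))}ᶜ)
    (hu_lap : ∀ x : EuclideanSpace ℝ (Fin (n + 1)), x ≠ 0 → laplacian u x = f x)
    {e ξ : EuclideanSpace ℝ (Fin (n + 1))} (he : ‖e‖ = 1) (hξ : ‖ξ‖ = 1) (heξ : ⟪e, ξ⟫ = 0) :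
    0 ≤ fderiv ℝ (fderiv ℝ u) e ξ ξ := by
  obtain ⟨m, hm⟩ : ∃ m, sInf (f '' sphere (0 : EuclideanSpace ℝ (Fin (n + 1))) 1) = m := ⟨_, rfl⟩
  rw [hm] at hf_seminorm
  have hes : e ∈ sphere (0 : EuclideanSpace ℝ (Fin (n + 1))) 1 := by simpa using he
  have he0 : e ≠ 0 := ne_zero_of_mem_unit_sphere ⟨e, hes⟩
  have hm0 : 0 ≤ m := hm ▸ Real.sInf_nonneg (by rintro _ ⟨x, hx, rfl⟩; exact (hf_pos x hx).le)
  have hme : m ≤ f e := hm ▸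
    csInf_le ⟨0, by rintro _ ⟨x, hx, rfl⟩; exact (hf_pos x hx).le⟩ ⟨e, hes, rfl⟩
  have hn0 : (0 : ℝ) < n := by positivity
  obtain ⟨v, hv⟩ : ∃ v, (fun x => u x - f e / n * ‖x‖) = v := ⟨_, rfl⟩
  have hvC2 : ContDiffOn ℝ 2 v {0}ᶜ := by
    rw [← hv]
    exact hu_C2.sub (contDiffOn_const.mul fun x hx =>
      (contDiffAt_norm ℝ hx).contDiffWithinAt)
  have hvhom : ∀ t : ℝ, 0 < t → ∀ y, y ≠ 0 → v (t • y) = t * v y := fun t ht y hy => by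
    simp only [← hv, hu_hom t ht y hy, norm_smul, Real.norm_eq_abs, abs_of_pos ht]
    ring
  obtain ⟨C, hb⟩ := exists_homBounds hvhom hvC2
  have hsecond : ∀ y ≠ 0, ∀ a b, fderiv ℝ (fderiv ℝ v) y a b = _ := fun y hy a b =>
    hv ▸ fderiv_fderiv_sub_norm hu_C2 (f e / n) hy a b
  have hsum : ∀ y ≠ 0, ∑ i, fderiv ℝ (fderiv ℝ v) y (EuclideanSpace.basisFun (Fin (n + 1)) ℝ i)
      (EuclideanSpace.basisFun (Fin (n + 1)) ℝ i) = ‖y‖⁻¹ * (f (‖y‖⁻¹ • y) - f e) := by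
    intro y hy
    have hy' : ‖y‖ ≠ 0 := norm_ne_zero_iff.2 hy
    have hpars : ∑ i, ⟪y, EuclideanSpace.basisFun (Fin (n + 1)) ℝ i⟫ *
        ⟪y, EuclideanSpace.basisFun (Fin (n + 1)) ℝ i⟫ = ‖y‖ ^ 2 := by
      rw [← real_inner_self_eq_norm_sq,
        ← (EuclideanSpace.basisFun (Fin (n + 1)) ℝ).sum_inner_mul_inner y y]
      simp_rw [real_inner_comm y]
    rw [hf_hom _ (by positivity) y hy, ← hu_lap y hy, laplacian_eq_sum hu_C2 hy]
    simp_rw [hsecond y hy, real_inner_self_eq_norm_sq, OrthonormalBasis.norm_eq_one]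
    rw [Finset.sum_sub_distrib, ← Finset.mul_sum, Finset.sum_sub_distrib, ← Finset.mul_sum,
      ← Finset.mul_sum, hpars]
    simp
    field_simp
    ring
  have hle : ∀ᵐ y, |∑ i, fderiv ℝ (fderiv ℝ v) y (EuclideanSpace.basisFun (Fin (n + 1)) ℝ i)
      (EuclideanSpace.basisFun (Fin (n + 1)) ℝ i)| * (‖y - e‖ ^ (n + 1))⁻¹ ≤
        gammaConst n α * m * gammaKernel n α e y := by
    have hae : ∀ᵐ y : EuclideanSpace ℝ (Fin (n + 1)), y ≠ 0 := by simp [ae_iff]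
    filter_upwards [hae] with y hy
    have hy' : 0 < ‖y‖ := norm_pos_iff.2 hy
    have hys : ‖y‖⁻¹ • y ∈ sphere (0 : EuclideanSpace ℝ (Fin (n + 1))) 1 := by
      simp [norm_smul, hy]
    rw [hsum y hy, abs_mul, abs_of_pos (inv_pos.2 hy')]
    calc _ ≤ ‖y‖⁻¹ * (gammaConst n α * m * Real.arccos ⟪‖y‖⁻¹ • y, e⟫ ^ α) *
          (‖y - e‖ ^ (n + 1))⁻¹ := by
          gcongr
          exact hf_seminorm _ hys e hes
      _ = _ := by rw [gammaKernel]; ring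
  obtain ⟨e₀, he₀⟩ : ∃ e₀ : EuclideanSpace ℝ (Fin (n + 1)), EuclideanSpace.single 0 1 = e₀ :=
    ⟨_, rfl⟩
  have he₀e : ‖e₀‖ = ‖e‖ := by rw [he, ← he₀]; simp
  have hγ : gammaConst n α = omega_n n / (n * (n + 1)) * (∫ y, gammaKernel n α e y)⁻¹ := by
    rw [integral_gammaKernel n α he₀e, ← he₀]
    rfl
  have hω : 0 < omega_n n := by
    rw [omega_n_eq]
    have : 0 < (volume : Measure (EuclideanSpace ℝ (Fin (n + 1)))).real (ball 0 1) :=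
      ENNReal.toReal_pos (measure_ball_pos _ _ one_pos).ne' measure_ball_lt_top.ne
    positivity
  have hJ : Integrable fun y => gammaConst n α * m * gammaKernel n α e y := by
    by_cases hi : Integrable (gammaKernel n α e)
    · exact hi.const_mul _
    · rw [hγ, integral_undef hi]
      simp
  have hJint : ∫ y, gammaConst n α * m * gammaKernel n α e y ≤ omega_n n / (n * (n + 1)) * m := by
    rw [integral_const_mul, hγ]
    calc _ = omega_n n / (n * (n + 1)) * m *
          ((∫ y, gammaKernel n α e y)⁻¹ * ∫ y, gammaKernel n α e y) := by ring
      _ ≤ omega_n n / (n * (n + 1)) * m * 1 := by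
          gcongr
          exact inv_mul_le_one
      _ = _ := mul_one _
  have habs := hb.abs_second_le (EuclideanSpace.basisFun (Fin (n + 1)) ℝ) (by omega)
    (Fintype.card_fin _) he hJ hle hξ
  rw [← omega_n_eq] at habs
  have h1 : |fderiv ℝ (fderiv ℝ v) e ξ ξ| ≤ m / (n + 1) := by
    refine le_of_mul_le_mul_left
      (habs.trans ((mul_le_mul_of_nonneg_left hJint hn0.le).trans_eq ?_)) hω
    field_simp
  have h2 : fderiv ℝ (fderiv ℝ v) e ξ ξ = fderiv ℝ (fderiv ℝ u) e ξ ξ - f e / n := by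
    rw [hsecond e he0, heξ, real_inner_self_eq_norm_sq, hξ, he]
    simp
  have h3 : m / (n + 1) ≤ f e / n := div_le_div₀ (hm0.trans hme) hme hn0 (by linarith)
  linarith [(abs_le.1 h1).1]

/-- if the `α`-Hölder seminorm of `f` (w.r.t. the spherical distance)
is at most `γ_{n,α} · min f`, then the solution is convex. -/
theorem stmt_6 (n : ℕ) (hn : 2 ≤ n) (α : ℝ) (hα : 0 < α) (hα1 : α < 1)
    (f u : EuclideanSpace ℝ (Fin (n + 1)) → ℝ)
    (hf_pos : ∀ x ∈ sphere (0 : EuclideanSpace ℝ (Fin (n + 1))) 1, 0 < f x)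
    (hf_hom : ∀ t : ℝ, 0 < t → ∀ y : EuclideanSpace ℝ (Fin (n + 1)), y ≠ 0 →
      f (t • y) = t⁻¹ * f y)
    (hf_seminorm : ∀ x ∈ sphere (0 : EuclideanSpace ℝ (Fin (n + 1))) 1,
      ∀ z ∈ sphere (0 : EuclideanSpace ℝ (Fin (n + 1))) 1,
        |f x - f z| ≤ gammaConst n α *
          sInf (f '' sphere (0 : EuclideanSpace ℝ (Fin (n + 1))) 1) *
          Real.arccos ⟪x, z⟫ ^ α)
    (hu_cont : Continuous u)
    (hu_hom : ∀ t : ℝ, 0 < t → ∀ y : EuclideanSpace ℝ (Fin (n + 1)), y ≠ 0 →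
      u (t • y) = t * u y)
    (hu_C2 : ContDiffOn ℝ 2 u {(0 : EuclideanSpace ℝ (Fin (n + 1)))}ᶜ)
    (hu_lap : ∀ x : EuclideanSpace ℝ (Fin (n + 1)), x ≠ 0 → laplacian u x = f x) :
    ConvexOn ℝ Set.univ u := by
  refine convexOn_univ_of_second_nonneg ?_ hu_cont hu_C2 fun y hy d =>
    second_nonneg_of_tangent hu_C2 hu_hom (fun e ξ he hξ heξ =>
      tangent_second_nonneg n hn α f u hf_pos hf_hom hf_seminorm hu_hom hu_C2 hu_lap he hξ heξ) hy d
  rw [finrank_euclideanSpace_fin]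
  omega
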